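/- arXiv:1302.4093 — 2 statements merged into one kernel-verified Lean document; each statement's English description precedes it below -/
import Mathlib

section
/- Existence of the stationary profile with exponential bounds: fix an integer N ≥ 2 and set m_s = (N−2)/(N+2). For every m̃ ∈ (m_s, 1) there exist a smooth, strictly positive function V : [0,∞) → (0,∞) with V′(0) = 0 and V ∈ H¹_rad, satisfying V″(r) + (N−1) coth(r) V′(r) + V(r)^{1/m̃} = 0 for all r > 0, and a constant A > 0 such that A^{−1} e^{−(N−1)r} ≤ V(r) ≤ A e^{−(N−1)r} for all r ≥ 0. -/
open MeasureTheory Set Filter Topology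

/-- Membership in the radial energy space `H¹_rad` on hyperbolic space `ℍ^N`:
`v` is locally absolutely continuous on `(0,∞)` (expressed via the fundamental theorem
of calculus for its a.e. derivative) and both `v` and `v'` are square-integrable with
respect to the weight `(sinh s)^(N-1)`. -/
def MemH1rad (N : ℕ) (v : ℝ → ℝ) : Prop :=
  (∀ a b : ℝ, 0 < a → a ≤ b → v b - v a = ∫ s in a..b, deriv v s) ∧
  MeasureTheory.IntegrableOn (fun s => (v s) ^ 2 * Real.sinh s ^ (N - 1)) (Set.Ioi 0) ∧
  MeasureTheory.IntegrableOn (fun s => (deriv v s) ^ 2 * Real.sinh s ^ (N - 1)) (Set.Ioi 0)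

/-- The squared `H¹` norm `‖v‖_2² + ‖v'‖_2²` with weight `(sinh s)^(N-1)`. -/
noncomputable def H1normSq (N : ℕ) (v : ℝ → ℝ) : ℝ :=
  (∫ s in Set.Ioi (0:ℝ), (v s) ^ 2 * Real.sinh s ^ (N - 1)) +
  (∫ s in Set.Ioi (0:ℝ), (deriv v s) ^ 2 * Real.sinh s ^ (N - 1))


theorem sp_maximizer {H : Type*} [NormedAddCommGroup H] [InnerProductSpace ℝ H] [CompleteSpace H]
    [TopologicalSpace.SeparableSpace H] {α : Type*} [MeasurableSpace α] (ν : Measure α)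
    (k : α → H) (hk : AEStronglyMeasurable k ν) (q : ℝ) (hq : 1 < q)
    (hint : Integrable (fun a => ‖k a‖ ^ q) ν) :
    ∃ h : H, ‖h‖ ≤ 1 ∧ ∀ h' : H, ‖h'‖ ≤ 1 →
      ∫ a, |inner ℝ h' (k a)| ^ q ∂ν ≤ ∫ a, |inner ℝ h (k a)| ^ q ∂ν := by
  set J : H → ℝ := fun h => ∫ a, |inner ℝ h (k a)| ^ q ∂ν with hJ
  have hq0 : 0 < q := by linarith
  have hpt : ∀ h : H, ‖h‖ ≤ 1 → ∀ a, |inner ℝ h (k a)| ^ q ≤ ‖k a‖ ^ q := by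
    intro h hh a
    apply Real.rpow_le_rpow (abs_nonneg _) _ hq0.le
    calc |inner ℝ h (k a)| ≤ ‖h‖ * ‖k a‖ := abs_real_inner_le_norm _ _
      _ ≤ 1 * ‖k a‖ := by gcongr
      _ = _ := one_mul _
  have hmeas : ∀ h : H, AEStronglyMeasurable (fun a => |inner ℝ h (k a)| ^ q) ν := by
    intro h
    have h1 : AEStronglyMeasurable (fun a => inner ℝ h (k a)) ν :=
      (aestronglyMeasurable_const (b := h)).inner hk
    have hc : Continuous (fun x : ℝ => |x| ^ q) :=
      continuous_abs.rpow_const (fun x => Or.inr hq0.le)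
    exact hc.comp_aestronglyMeasurable h1
  have hJle : ∀ h : H, ‖h‖ ≤ 1 → J h ≤ ∫ a, ‖k a‖ ^ q ∂ν := by
    intro h hh
    apply integral_mono_of_nonneg _ hint (Eventually.of_forall (hpt h hh))
    exact Eventually.of_forall (fun a => by positivity)
  set S : Set ℝ := J '' {h | ‖h‖ ≤ 1} with hS
  have hSne : S.Nonempty := ⟨J 0, 0, by simp, rfl⟩
  have hSbd : BddAbove S := by
    refine ⟨∫ a, ‖k a‖ ^ q ∂ν, ?_⟩
    rintro _ ⟨h, hh, rfl⟩
    exact hJle h hh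
  obtain ⟨u, -, hulim, huS⟩ := exists_seq_tendsto_sSup hSne hSbd
  choose x hx hxu using huS
  have hsc := WeakDual.isSeqCompact_closedBall ℝ H (0 : StrongDual ℝ H) 1
  have hmem : ∀ n, (StrongDual.toWeakDual (InnerProductSpace.toDual ℝ H (x n))) ∈
      (WeakDual.toStrongDual ⁻¹' Metric.closedBall (0 : StrongDual ℝ H) 1) := by
    intro n
    simp only [mem_preimage, Metric.mem_closedBall, dist_zero_right]
    have : ‖(InnerProductSpace.toDual ℝ H) (x n)‖ ≤ 1 := by
      rw [LinearIsometryEquiv.norm_map]; exact hx n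
    exact this
  obtain ⟨y, hy, φ, hφ, hlim⟩ := hsc hmem
  have hlim' : ∀ z : H, Tendsto (fun n => inner ℝ (x (φ n)) z) atTop (𝓝 (y z)) := by
    intro z
    have := ((WeakDual.eval_continuous z).tendsto y).comp hlim
    exact this
  set h : H := (InnerProductSpace.toDual ℝ H).symm (WeakDual.toStrongDual y) with hh
  have hhy : ∀ z, inner ℝ h z = y z := by
    intro z
    rw [hh, InnerProductSpace.toDual_symm_apply]
    rfl
  have hh1 : ‖h‖ ≤ 1 := by
    rw [hh, LinearIsometryEquiv.norm_map]
    simpa using hy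
  refine ⟨h, hh1, ?_⟩
  have hJlim : Tendsto (fun n => J (x (φ n))) atTop (𝓝 (J h)) := by
    apply tendsto_integral_of_dominated_convergence (fun a => ‖k a‖ ^ q)
    · intro n; exact hmeas _
    · exact hint
    · intro n
      refine Eventually.of_forall fun a => ?_
      rw [Real.norm_of_nonneg (by positivity)]
      exact hpt _ (hx _) a
    · refine Eventually.of_forall fun a => ?_
      rw [hhy]
      have hc : Continuous (fun x : ℝ => |x| ^ q) :=
        continuous_abs.rpow_const (fun x => Or.inr hq0.le)
      exact (hc.tendsto _).comp (hlim' (k a))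
  have hJs : J h = sSup S := by
    refine tendsto_nhds_unique hJlim ?_
    have : (fun n => J (x (φ n))) = u ∘ φ := by
      ext n; exact hxu (φ n)
    rw [this]
    exact hulim.comp hφ.tendsto_atTop
  intro h' hh'
  change J h' ≤ J h
  rw [hJs]
  exact le_csSup hSbd ⟨h', hh', rfl⟩

theorem sp_euler {H : Type*} [NormedAddCommGroup H] [InnerProductSpace ℝ H] [CompleteSpace H]
    {α : Type*} [MeasurableSpace α] (ν : Measure α)
    (k : α → H) (hk : AEStronglyMeasurable k ν) (p : ℝ) (hp : 1 < p)
    (hint : Integrable (fun a => ‖k a‖ ^ (p + 1)) ν) (hkk : ∀ a b, 0 ≤ inner ℝ (k a) (k b))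
    (h : H) (hh1 : ‖h‖ ≤ 1) (hpos : ∀ a, 0 ≤ inner ℝ h (k a))
    (hmax : ∀ h' : H, ‖h'‖ ≤ 1 →
      ∫ a, |inner ℝ h' (k a)| ^ (p + 1) ∂ν ≤ ∫ a, |inner ℝ h (k a)| ^ (p + 1) ∂ν)
    (hJ : 0 < ∫ a, |inner ℝ h (k a)| ^ (p + 1) ∂ν) :
    ∃ M > 0, ∀ b, Integrable (fun a => (inner ℝ h (k a)) ^ p * inner ℝ (k a) (k b)) ν ∧
      M * inner ℝ h (k b) = ∫ a, (inner ℝ h (k a)) ^ p * inner ℝ (k a) (k b) ∂ν := by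
  have hp0 : 0 < p := by linarith
  have hpt : ∀ h : H, ‖h‖ ≤ 1 → ∀ a, |inner ℝ h (k a)| ≤ ‖k a‖ := by
    intro h hh a
    calc |inner ℝ h (k a)| ≤ ‖h‖ * ‖k a‖ := abs_real_inner_le_norm _ _
      _ ≤ 1 * ‖k a‖ := by gcongr
      _ = _ := one_mul _
  have hin : ∀ h : H, AEStronglyMeasurable (fun a => inner ℝ h (k a)) ν := fun h =>
      (aestronglyMeasurable_const (b := h)).inner hk
  have hJint : ∀ h : H, ‖h‖ ≤ 1 → Integrable (fun a => |inner ℝ h (k a)| ^ (p + 1)) ν := by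
    intro h hh
    refine hint.mono' ?_ (Eventually.of_forall fun a => ?_)
    · have hc : Continuous (fun x : ℝ => |x| ^ (p + 1)) :=
        continuous_abs.rpow_const (fun x => Or.inr (by linarith))
      exact hc.comp_aestronglyMeasurable (hin h)
    · rw [Real.norm_of_nonneg (by positivity)]
      exact Real.rpow_le_rpow (abs_nonneg _) (hpt h hh a) (by linarith)
  have hvle : ∀ a, inner ℝ h (k a) ≤ ‖k a‖ := fun a => (le_abs_self _).trans (hpt h hh1 a)
  have hmp : AEStronglyMeasurable (fun a => (inner ℝ h (k a)) ^ p) ν := by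
    have hc : Continuous (fun x : ℝ => x ^ p) :=
        continuous_id.rpow_const (fun x => Or.inr hp0.le)
    exact hc.comp_aestronglyMeasurable (hin h)
  have hΦint : Integrable (fun a => ((inner ℝ h (k a)) ^ p) • k a) ν := by
    refine hint.mono' (hmp.smul hk) (Eventually.of_forall fun a => ?_)
    rw [norm_smul, Real.norm_of_nonneg (Real.rpow_nonneg (hpos a) _)]
    rw [Real.rpow_add_one' (norm_nonneg _) (by linarith)]
    gcongr
    · exact hpos a
    · exact hvle a
  set Φ : H := ∫ a, ((inner ℝ h (k a)) ^ p) • k a ∂ν with hΦ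
  have hΦin : ∀ z, inner ℝ Φ z = ∫ a, (inner ℝ h (k a)) ^ p * inner ℝ (k a) z ∂ν := by
    intro z
    rw [real_inner_comm, hΦ, ← integral_inner hΦint]
    congr 1; ext a
    rw [inner_smul_right, real_inner_comm z (k a)]
  have hzint : ∀ z, Integrable (fun a => (inner ℝ h (k a)) ^ p * inner ℝ (k a) z) ν := by
    intro z
    have := hΦint.inner_const (𝕜 := ℝ) z
    refine this.congr (Eventually.of_forall fun a => ?_)
    simp only [inner_smul_left]
    rfl
  have hΦh : inner ℝ Φ h = ∫ a, |inner ℝ h (k a)| ^ (p + 1) ∂ν := by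
    rw [hΦin]
    congr 1; ext a
    rw [abs_of_nonneg (hpos a), Real.rpow_add_one' (hpos a) (by linarith), real_inner_comm h]
  have hΦ0 : 0 < ‖Φ‖ := by
    rw [norm_pos_iff]
    intro h0
    rw [h0, inner_zero_left] at hΦh
    linarith
  set φ : H := (‖Φ‖)⁻¹ • Φ with hφ
  have hφ1 : ‖φ‖ = 1 := by
    rw [hφ, norm_smul, norm_inv, norm_norm]; field_simp
  have hφpos : ∀ a, 0 ≤ inner ℝ φ (k a) := by
    intro b
    rw [hφ, real_inner_smul_left, hΦin]
    apply mul_nonneg (by positivity)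
    apply integral_nonneg
    intro a
    exact mul_nonneg (Real.rpow_nonneg (hpos a) _) (hkk a b)
  have hkey : inner ℝ Φ φ ≤ inner ℝ Φ h := by
    have hy : ∀ a, (inner ℝ h (k a)) ^ p * inner ℝ (k a) φ ≤
        p / (p + 1) * |inner ℝ h (k a)| ^ (p + 1) + 1 / (p + 1) * |inner ℝ φ (k a)| ^ (p + 1) := by
      intro a
      rw [real_inner_comm φ (k a)]
      have hc : Real.HolderConjugate ((p + 1) / p) (p + 1) := by
        rw [Real.holderConjugate_iff]
        constructor
        · rw [lt_div_iff₀ hp0]; linarith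
        · field_simp
          try ring
      have := Real.young_inequality_of_nonneg (Real.rpow_nonneg (hpos a) p) (hφpos a) hc
      rw [← Real.rpow_mul (hpos a), mul_div_cancel₀ _ hp0.ne'] at this
      rw [abs_of_nonneg (hpos a), abs_of_nonneg (hφpos a)]
      refine this.trans (le_of_eq ?_)
      field_simp
    have h1 := integral_mono (hzint φ)
      (((hJint h hh1).const_mul (p / (p + 1))).add ((hJint φ hφ1.le).const_mul (1 / (p + 1)))) hy
    rw [← hΦin] at h1
    simp only [Pi.add_apply] at h1
    rw [integral_add ((hJint h hh1).const_mul (p / (p + 1)))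
      ((hJint φ hφ1.le).const_mul (1 / (p + 1))), integral_const_mul, integral_const_mul] at h1
    have h2 := hmax φ hφ1.le
    rw [hΦh]
    refine h1.trans ?_
    have h3 : 1 / (p + 1) * ∫ a, |inner ℝ φ (k a)| ^ (p + 1) ∂ν ≤
        1 / (p + 1) * ∫ a, |inner ℝ h (k a)| ^ (p + 1) ∂ν := by gcongr
    refine (add_le_add_right h3 _).trans (le_of_eq ?_)
    field_simp
  have hn : inner ℝ Φ φ = ‖Φ‖ := by
    rw [hφ, real_inner_smul_right, real_inner_self_eq_norm_sq]; field_simp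
  have hzero : ‖Φ - ‖Φ‖ • h‖ ^ 2 ≤ 0 := by
    rw [@norm_sub_sq ℝ, real_inner_smul_right, norm_smul, norm_norm]
    simp only [RCLike.re_to_real]
    have : ‖h‖ ^ 2 ≤ 1 := by
      have := norm_nonneg h
      nlinarith
    rw [hn] at hkey
    nlinarith [mul_le_mul_of_nonneg_left this (sq_nonneg ‖Φ‖), mul_le_mul_of_nonneg_left hkey hΦ0.le]
  have heq : Φ = ‖Φ‖ • h := by
    have : ‖Φ - ‖Φ‖ • h‖ = 0 := by
      have := norm_nonneg (Φ - ‖Φ‖ • h)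
      nlinarith
    rw [norm_eq_zero] at this
    exact sub_eq_zero.mp this
  refine ⟨‖Φ‖, hΦ0, fun b => ⟨hzint (k b), ?_⟩⟩
  rw [← hΦin, ← real_inner_smul_left, ← heq]


noncomputable def spE (τ : ℝ) : Lp ℝ 2 (volume : Measure ℝ) :=
  indicatorConstLp 2 (measurableSet_Ioc : MeasurableSet (Ioc (0:ℝ) τ)) measure_Ioc_lt_top.ne 1

theorem spE_inner (a b : ℝ) : inner ℝ (spE a) (spE b) = max (min a b) 0 := by
  unfold spE
  rw [L2.inner_indicatorConstLp_indicatorConstLp _ _ measure_Ioc_lt_top.ne measure_Ioc_lt_top.ne,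
    Ioc_inter_Ioc, Measure.real, Real.volume_Ioc, ENNReal.toReal_ofReal']
  simp

theorem spE_norm_sq (a : ℝ) : ‖spE a‖ ^ 2 = max a 0 := by
  rw [← real_inner_self_eq_norm_sq, spE_inner, min_self]

theorem spE_continuous : Continuous spE := by
  rw [continuous_iff_continuousAt]
  intro a
  rw [ContinuousAt, tendsto_iff_norm_sub_tendsto_zero]
  have h1 : ∀ x, ‖spE x - spE a‖ = Real.sqrt (max x 0 - 2 * max (min x a) 0 + max a 0) := by
    intro x
    rw [← Real.sqrt_sq (norm_nonneg (spE x - spE a)), @norm_sub_sq ℝ, spE_norm_sq, spE_norm_sq,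
      spE_inner]
    simp
  simp only [h1]
  have h2 : Continuous (fun x : ℝ => Real.sqrt (max x 0 - 2 * max (min x a) 0 + max a 0)) := by
    fun_prop
  have h3 := h2.tendsto a
  simp only [min_self] at h3
  rw [show max a 0 - 2 * max a 0 + max a 0 = 0 by ring, Real.sqrt_zero] at h3
  exact h3

theorem spE_abs (h : Lp ℝ 2 (volume : Measure ℝ)) (a : ℝ) :
    |inner ℝ h (spE a)| ≤ inner ℝ |h| (spE a) := by
  rw [real_inner_comm, real_inner_comm _ |h|]
  unfold spE
  rw [L2.inner_indicatorConstLp_one, L2.inner_indicatorConstLp_one]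
  refine abs_integral_le_integral_abs.trans (le_of_eq ?_)
  apply integral_congr_ae
  have := Lp.coeFn_abs h
  exact (ae_restrict_of_ae this).mono (fun x hx => hx.symm)

theorem sp_core (σ t : ℝ → ℝ) (p : ℝ) (hp : 1 < p) (hσ0 : ∀ r, 0 ≤ σ r)
    (hσ : ∀ r > 0, 0 < σ r) (hσc : ContinuousOn σ (Ioi 0)) (htc : ContinuousOn t (Ioi 0))
    (htp : ∀ r > 0, 0 < t r) (hta : AntitoneOn t (Ioi 0))
    (hint : IntegrableOn (fun r => σ r * (t r) ^ ((p + 1) / 2)) (Ioi 0)) :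
    ∃ V : ℝ → ℝ, (∀ r > 0, 0 < V r) ∧ ContinuousOn V (Ioi 0) ∧
      (∃ C > 0, ∀ r > 0, V r ≤ C * (t r) ^ ((1:ℝ) / 2)) ∧
      ∀ ρ > 0, IntegrableOn (fun r => σ r * V r ^ p * t (max r ρ)) (Ioi 0) ∧
        V ρ = ∫ r in Ioi 0, σ r * V r ^ p * t (max r ρ) := by
  set q := p + 1 with hq
  have hq0 : 0 < q := by linarith
  have hp0 : 0 < p := by linarith
  set c : ℝ → ℝ := fun r => (σ r) ^ (1 / q) with hc
  have hc0 : ∀ r, 0 ≤ c r := fun r => Real.rpow_nonneg (hσ0 r) _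
  have hcp : ∀ r > 0, 0 < c r := fun r hr => Real.rpow_pos_of_pos (hσ r hr) _
  have hcq : ∀ r, (c r) ^ q = σ r := by
    intro r
    rw [hc]
    simp only
    rw [← Real.rpow_mul (hσ0 r), one_div, inv_mul_cancel₀ hq0.ne', Real.rpow_one]
  set k : ℝ → Lp ℝ 2 (volume : Measure ℝ) := fun r => c r • spE (t r) with hk
  set ν : Measure ℝ := volume.restrict (Ioi 0) with hν
  have hkm : AEStronglyMeasurable k ν := by
    apply ContinuousOn.aestronglyMeasurable _ measurableSet_Ioi
    refine ContinuousOn.smul (f := c) (g := fun r => spE (t r)) ?_ ?_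
    · exact hσc.rpow_const (fun x hx => Or.inr (by positivity))
    · exact spE_continuous.comp_continuousOn htc
  have hEn : ∀ r > 0, ‖spE (t r)‖ = (t r) ^ ((1:ℝ) / 2) := by
    intro r hr
    rw [← Real.sqrt_eq_rpow, ← Real.sqrt_sq (norm_nonneg (spE (t r))), spE_norm_sq,
      max_eq_left (htp r hr).le]
  have hkint : Integrable (fun a => ‖k a‖ ^ q) ν := by
    refine hint.congr_fun ?_ measurableSet_Ioi
    intro r hr
    simp only [hk]
    rw [norm_smul, Real.norm_of_nonneg (hc0 r), Real.mul_rpow (hc0 r) (norm_nonneg _), hcq,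
      hEn r hr, ← Real.rpow_mul (htp r hr).le]
    congr 2; ring
  have hkk : ∀ a b, inner ℝ (k a) (k b) = c a * c b * max (min (t a) (t b)) 0 := by
    intro a b
    simp only [hk]
    rw [real_inner_smul_left, real_inner_smul_right, spE_inner]; ring
  have hkk0 : ∀ a b, 0 ≤ inner ℝ (k a) (k b) := by
    intro a b
    rw [hkk]
    exact mul_nonneg (mul_nonneg (hc0 a) (hc0 b)) (le_max_right _ _)
  have : Fact ((2 : ENNReal) ≠ ⊤) := ⟨by simp⟩
  obtain ⟨h0, hh0, hmax0⟩ := sp_maximizer ν k hkm q (by linarith) hkint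
  set h := |h0| with hh
  have hh1 : ‖h‖ ≤ 1 := by rw [hh, norm_abs_eq_norm]; exact hh0
  have hle : ∀ a, |inner ℝ h0 (k a)| ≤ inner ℝ h (k a) := by
    intro a
    simp only [hk]
    rw [real_inner_smul_right, real_inner_smul_right, abs_mul, abs_of_nonneg (hc0 a)]
    exact mul_le_mul_of_nonneg_left (spE_abs h0 _) (hc0 a)
  have hpos : ∀ a, 0 ≤ inner ℝ h (k a) := fun a => (abs_nonneg _).trans (hle a)
  have hcont : Continuous (fun x : ℝ => |x| ^ q) :=
        continuous_abs.rpow_const (fun x => Or.inr hq0.le)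
  have hJint : ∀ h : Lp ℝ 2 (volume : Measure ℝ), ‖h‖ ≤ 1 →
      Integrable (fun a => |inner ℝ h (k a)| ^ q) ν := by
    intro h hh
    refine hkint.mono' ?_ (Eventually.of_forall fun a => ?_)
    · exact hcont.comp_aestronglyMeasurable ((aestronglyMeasurable_const (b := h)).inner hkm)
    · rw [Real.norm_of_nonneg (by positivity)]
      refine Real.rpow_le_rpow (abs_nonneg _) ?_ (by linarith)
      calc |inner ℝ h (k a)| ≤ ‖h‖ * ‖k a‖ := abs_real_inner_le_norm _ _
        _ ≤ 1 * ‖k a‖ := by gcongr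
        _ = _ := one_mul _
  have hmax : ∀ h' : Lp ℝ 2 (volume : Measure ℝ), ‖h'‖ ≤ 1 →
      ∫ a, |inner ℝ h' (k a)| ^ q ∂ν ≤ ∫ a, |inner ℝ h (k a)| ^ q ∂ν := by
    intro h' hh'
    refine (hmax0 h' hh').trans ?_
    apply integral_mono (hJint h0 hh0) (hJint h hh1)
    intro a
    simp only
    rw [abs_of_nonneg (hpos a)]
    exact Real.rpow_le_rpow (abs_nonneg _) (hle a) hq0.le
  have hJpos : 0 < ∫ a, |inner ℝ h (k a)| ^ q ∂ν := by
    set e := spE (t 1) with he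
    have hep : 0 < ‖e‖ := by rw [hEn 1 one_pos]; exact Real.rpow_pos_of_pos (htp 1 one_pos) _
    set h' := (‖e‖)⁻¹ • e with hh'
    have hh'1 : ‖h'‖ ≤ 1 := by
      rw [hh', norm_smul, norm_inv, norm_norm, inv_mul_cancel₀ hep.ne']
    refine lt_of_lt_of_le ?_ (hmax h' hh'1)
    rw [integral_pos_iff_support_of_nonneg (fun a => by positivity) (hJint h' hh'1)]
    have hsub : Ioi (0:ℝ) ⊆ Function.support (fun a => |inner ℝ h' (k a)| ^ q) := by
      intro r hr
      have hr' : 0 < r := hr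
      simp only [Function.mem_support]
      apply ne_of_gt
      apply Real.rpow_pos_of_pos
      rw [abs_pos, hh', hk]
      simp only
      rw [real_inner_smul_left, real_inner_smul_right, he, spE_inner]
      have h1 := htp r hr'
      have h2 := htp 1 one_pos
      have h3 : 0 < max (min (t 1) (t r)) 0 := lt_max_of_lt_left (lt_min h2 h1)
      have := hcp r hr'
      positivity
    refine lt_of_lt_of_le ?_ (measure_mono hsub)
    rw [hν, Measure.restrict_apply_self, Real.volume_Ioi]
    simp
  obtain ⟨M, hM, hEul⟩ := sp_euler ν k hkm p hp hkint hkk0 h hh1 hpos hmax hJpos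
  set v : ℝ → ℝ := fun r => inner ℝ h (spE (t r)) with hv
  have hvk : ∀ r, inner ℝ h (k r) = c r * v r := by
    intro r; simp only [hk, hv]; rw [real_inner_smul_right]
  have hv0 : ∀ r, 0 ≤ v r := fun r => (abs_nonneg _).trans (spE_abs h0 (t r))
  have hrew : ∀ ρ > 0, ∀ r ∈ Ioi (0:ℝ), (inner ℝ h (k r)) ^ p * inner ℝ (k r) (k ρ) =
      c ρ * (σ r * v r ^ p * t (max r ρ)) := by
    intro ρ hρ r hr
    have hr' : 0 < r := hr
    have hm : max (min (t r) (t ρ)) 0 = t (max r ρ) := by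
      rcases le_total r ρ with hl | hl
      · rw [min_eq_right (hta hr hρ hl), max_eq_left (htp ρ hρ).le, max_eq_right hl]
      · rw [min_eq_left (hta hρ hr hl), max_eq_left (htp r hr).le, max_eq_left hl]
    rw [hvk, hkk, hm, Real.mul_rpow (hc0 r) (hv0 r), ← hcq r, hq,
      Real.rpow_add_one' (hc0 r) (by linarith)]
    ring
  have hI : ∀ ρ > 0, IntegrableOn (fun r => σ r * v r ^ p * t (max r ρ)) (Ioi 0) ∧
        M * v ρ = ∫ r in Ioi 0, σ r * v r ^ p * t (max r ρ) := by
    intro ρ hρ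
    obtain ⟨e1, e2⟩ := hEul ρ
    have hcρ := hcp ρ hρ
    constructor
    · have e3 : IntegrableOn (fun r => c ρ * (σ r * v r ^ p * t (max r ρ))) (Ioi 0) :=
        IntegrableOn.congr_fun e1 (hrew ρ hρ) measurableSet_Ioi
      have e4 := e3.const_mul (c ρ)⁻¹
      refine e4.congr (Eventually.of_forall fun r => ?_)
      simp only
      rw [inv_mul_cancel_left₀ hcρ.ne']
    · rw [setIntegral_congr_fun measurableSet_Ioi (hrew ρ hρ), integral_const_mul, hvk] at e2
      apply mul_left_cancel₀ hcρ.ne'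
      rw [← e2]; ring
  have hvpos : ∀ ρ > 0, 0 < v ρ := by
    intro ρ hρ
    refine lt_of_le_of_ne (hv0 ρ) (fun h00 => ?_)
    obtain ⟨e1, e2⟩ := hI ρ hρ
    rw [← h00, mul_zero] at e2
    have hnn : 0 ≤ᵐ[ν] (fun r => σ r * v r ^ p * t (max r ρ)) := by
      refine (ae_restrict_mem measurableSet_Ioi).mono (fun r hr => ?_)
      have := htp (max r ρ) (lt_max_of_lt_right hρ)
      have := Real.rpow_nonneg (hv0 r) p
      have := hσ0 r
      simp only [Pi.zero_apply]
      positivity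
    have e3 := (integral_eq_zero_iff_of_nonneg_ae hnn e1).mp e2.symm
    have e4 : (fun a => |inner ℝ h (k a)| ^ q) =ᵐ[ν] 0 := by
      filter_upwards [e3, ae_restrict_mem measurableSet_Ioi] with r hr hr0
      have hr' : 0 < r := hr0
      simp only [Pi.zero_apply] at hr ⊢
      have h1 := htp (max r ρ) (lt_max_of_lt_right hρ)
      have h2 := hσ r hr'
      have h3 : v r ^ p = 0 := by
        rcases mul_eq_zero.mp hr with h4 | h4
        · rcases mul_eq_zero.mp h4 with h5 | h5
          · linarith
          · exact h5
        · linarith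
      rw [Real.rpow_eq_zero (hv0 r) hp0.ne'] at h3
      rw [hvk, h3, mul_zero, abs_zero, Real.zero_rpow hq0.ne']
    rw [integral_congr_ae e4] at hJpos
    simp at hJpos
  have hpm : p - 1 ≠ 0 := by linarith
  set l : ℝ := (M⁻¹) ^ (1 / (p - 1)) with hl
  have hlp : 0 < l := Real.rpow_pos_of_pos (inv_pos.mpr hM) _
  have hlM : l ^ p = l * M⁻¹ := by
    have h1 : l ^ (p - 1) = M⁻¹ := by
      rw [hl, ← Real.rpow_mul (inv_pos.mpr hM).le, one_div, inv_mul_cancel₀ hpm, Real.rpow_one]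
    rw [← h1, mul_comm, ← Real.rpow_add_one hlp.ne']; congr 1; ring
  refine ⟨fun r => l * v r, fun r hr => mul_pos hlp (hvpos r hr), ?_, ⟨l, hlp, ?_⟩, ?_⟩
  · apply ContinuousOn.const_mul
    exact ContinuousOn.inner (𝕜 := ℝ) continuousOn_const (spE_continuous.comp_continuousOn htc)
  · intro r hr
    apply mul_le_mul_of_nonneg_left _ hlp.le
    rw [← hEn r hr]
    calc v r ≤ ‖h‖ * ‖spE (t r)‖ := real_inner_le_norm _ _
      _ ≤ 1 * ‖spE (t r)‖ := by gcongr
      _ = _ := one_mul _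
  · intro ρ hρ
    obtain ⟨e1, e2⟩ := hI ρ hρ
    have hr : (fun r => σ r * (l * v r) ^ p * t (max r ρ)) =
        fun r => l * M⁻¹ * (σ r * v r ^ p * t (max r ρ)) := by
      ext r
      rw [Real.mul_rpow hlp.le (hv0 r), hlM]; ring
    rw [hr]
    refine ⟨e1.const_mul _, ?_⟩
    rw [integral_const_mul, ← e2]
    field_simp


theorem sp_mono {S : Set ℝ} (hS : Convex ℝ S) {f f' : ℝ → ℝ}
    (hd : ∀ x ∈ S, HasDerivAt f (f' x) x) (h0 : ∀ x ∈ S, 0 ≤ f' x) : MonotoneOn f S :=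
  monotoneOn_of_hasDerivWithinAt_nonneg hS
    (fun x hx => (hd x hx).continuousAt.continuousWithinAt)
    (fun x hx => (hd x (interior_subset hx)).hasDerivWithinAt)
    (fun x hx => h0 x (interior_subset hx))

theorem sp_le_zero {a : ℝ} {f f' : ℝ → ℝ}
    (hd : ∀ x ∈ Ici a, HasDerivAt f (f' x) x) (h0 : ∀ x ∈ Ici a, 0 ≤ f' x)
    (hl : Tendsto f atTop (𝓝 0)) : ∀ x ∈ Ici a, f x ≤ 0 := by
  intro x hx
  have hm := sp_mono (convex_Ici a) hd h0
  refine ge_of_tendsto hl ?_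
  filter_upwards [eventually_ge_atTop x] with y hy
  exact hm hx (le_trans hx hy) hy

theorem sp_sinh_ge {r : ℝ} (hr : 1 ≤ r) : Real.exp r / 4 ≤ Real.sinh r := by
  rw [Real.sinh_eq]
  have h1 : Real.exp (-r) ≤ 1 := by rw [Real.exp_le_one_iff]; linarith
  have h2 : 2 ≤ Real.exp r := by linarith [Real.add_one_le_exp r]
  linarith

theorem sp_sinh_le {r : ℝ} : Real.sinh r ≤ Real.exp r := by
  rw [Real.sinh_eq]
  have h1 := Real.exp_pos (-r)
  have h2 := Real.exp_pos r
  linarith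

theorem sp_sinh_le_two {r : ℝ} (h0 : 0 ≤ r) (hr : r ≤ 1) : Real.sinh r ≤ 2 * r := by
  have hm : MonotoneOn (fun x => 2 * x - Real.sinh x) (Icc 0 1) := by
    apply sp_mono (convex_Icc 0 1) (f' := fun x => 2 * 1 - Real.cosh x)
    · intro x _
      exact ((hasDerivAt_id x).const_mul 2).sub (Real.hasDerivAt_sinh x)
    · intro x hx
      have h1 : Real.cosh x ≤ Real.cosh 1 := by
        rw [Real.cosh_le_cosh, abs_of_nonneg hx.1, abs_one]; exact hx.2
      have h2 : Real.cosh 1 ≤ 2 := by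
        rw [Real.cosh_eq]
        have h3 := Real.exp_one_lt_d9
        have h4 : Real.exp (-1) ≤ 1 := by rw [Real.exp_le_one_iff]; norm_num
        linarith
      linarith
  have := hm (left_mem_Icc.mpr zero_le_one) ⟨h0, hr⟩ h0
  simp at this
  linarith

theorem sp_inv_le {m : ℕ} {r : ℝ} (hr : 1 ≤ r) :
    (Real.sinh r ^ m)⁻¹ ≤ 4 ^ m * Real.exp (-(m : ℝ) * r) := by
  have h1 : (Real.exp r / 4) ^ m ≤ Real.sinh r ^ m := by
    gcongr
    exact sp_sinh_ge hr
  calc (Real.sinh r ^ m)⁻¹ ≤ ((Real.exp r / 4) ^ m)⁻¹ := by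
        apply inv_anti₀ _ h1
        positivity
    _ = _ := by
      rw [div_pow, ← Real.exp_nat_mul, inv_div, neg_mul, Real.exp_neg]
      rfl

theorem sp_expo_tendsto {c : ℝ} (hc : c < 0) : Tendsto (fun r => Real.exp (c * r)) atTop (𝓝 0) := by
  apply Real.tendsto_exp_atBot.comp
  exact tendsto_id.const_mul_atTop_of_neg hc

theorem sp_expo_deriv (c r : ℝ) : HasDerivAt (fun r => Real.exp (c * r)) (c * Real.exp (c * r)) r := by
  have := ((hasDerivAt_id r).const_mul c).exp
  simp only [id] at this
  convert this using 1
  ring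

theorem sp_t (m : ℕ) (hm : 1 ≤ m) : ∃ t : ℝ → ℝ,
    (∀ r > 0, HasDerivAt t (-(Real.sinh r ^ m)⁻¹) r) ∧ (∀ r > 0, 0 < t r) ∧
    AntitoneOn t (Ioi 0) ∧
    (∃ C > 0, ∀ r ≥ 1, t r ≤ C * Real.exp (-(m : ℝ) * r)) ∧
    (∀ a > 0, (m : ℝ) - 1 ≤ a → ∃ C > 0, ∀ r ∈ Ioc (0:ℝ) 1, t r ≤ C * r ^ (-a)) := by
  have hm0 : (0:ℝ) < m := by exact_mod_cast hm
  set w : ℝ → ℝ := fun s => (Real.sinh s ^ m)⁻¹ with hw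
  have hwp : ∀ s > 0, 0 < w s := by
    intro s hs
    have := Real.sinh_pos_iff.mpr hs
    simp only [hw]; positivity
  have hwc : ContinuousOn w (Ioi 0) := by
    apply ContinuousOn.inv₀
    · exact (Real.continuous_sinh.pow m).continuousOn
    · intro s hs
      have := Real.sinh_pos_iff.mpr hs
      positivity
  have hwi : IntegrableOn w (Ioi 1) := by
    have h1 : IntegrableOn (fun r => 4 ^ m * Real.exp (-(m : ℝ) * r)) (Ioi 1) :=
      (integrableOn_exp_mul_Ioi (by linarith) 1).const_mul _
    refine h1.mono' ((hwc.mono (Ioi_subset_Ioi zero_le_one)).aestronglyMeasurable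
      measurableSet_Ioi) ?_
    refine (ae_restrict_mem measurableSet_Ioi).mono (fun r hr => ?_)
    have hr' : 1 < r := hr
    rw [Real.norm_of_nonneg (hwp r (by linarith)).le]
    exact sp_inv_le hr'.le
  set t : ℝ → ℝ := fun r => (∫ s in Ioi 1, w s) - ∫ s in (1:ℝ)..r, w s with ht
  have htd : ∀ r > 0, HasDerivAt t (-(Real.sinh r ^ m)⁻¹) r := by
    intro r hr
    have hi : IntervalIntegrable w volume 1 r := by
      apply ContinuousOn.intervalIntegrable
      apply hwc.mono
      intro x hx
      exact lt_of_lt_of_le (lt_min one_pos hr) hx.1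
    have := intervalIntegral.integral_hasDerivAt_right hi
      (hwc.stronglyMeasurableAtFilter isOpen_Ioi r hr) (hwc.continuousAt (Ioi_mem_nhds hr))
    simpa using this.const_sub (∫ s in Ioi 1, w s)
  have htl : Tendsto t atTop (𝓝 0) := by
    have := (intervalIntegral_tendsto_integral_Ioi 1 hwi tendsto_id).const_sub (∫ s in Ioi 1, w s)
    simpa using this
  have hta : StrictAntiOn t (Ioi 0) := by
    apply strictAntiOn_of_deriv_neg (convex_Ioi 0)
    · exact fun x hx => (htd x hx).continuousAt.continuousWithinAt
    · intro x hx
      rw [interior_Ioi] at hx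
      rw [(htd x hx).deriv]
      linarith [hwp x hx]
  refine ⟨t, htd, ?_, hta.antitoneOn, ⟨4 ^ m / m, by positivity, ?_⟩, ?_⟩
  · intro r hr
    have h1 : t (r + 1) < t r := hta hr (show (0:ℝ) < r + 1 by linarith) (by linarith)
    have h2 : 0 ≤ t (r + 1) := by
      refine le_of_tendsto htl ?_
      filter_upwards [eventually_ge_atTop (r + 1)] with y hy
      exact hta.antitoneOn (show (0:ℝ) < r + 1 by linarith) (show (0:ℝ) < y by linarith) hy
    linarith
  · intro r hr
    have := sp_le_zero (a := 1) (f := fun r => t r - 4 ^ m / m * Real.exp (-(m : ℝ) * r))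
      (f' := fun r => -(Real.sinh r ^ m)⁻¹ - 4 ^ m / m * (-(m : ℝ) * Real.exp (-(m : ℝ) * r)))
      (fun x hx => (htd x (lt_of_lt_of_le one_pos hx)).sub ((sp_expo_deriv _ x).const_mul _))
      (fun x hx => by
        have h1 := sp_inv_le (m := m) hx
        have h2 : 4 ^ m / m * (-(m : ℝ) * Real.exp (-(m : ℝ) * x)) =
          -(4 ^ m * Real.exp (-(m : ℝ) * x)) := by field_simp
        rw [h2]
        linarith)
      (by simpa using htl.sub ((sp_expo_tendsto (c := -(m : ℝ)) (by linarith)).const_mul _)) r hr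
    linarith
  · intro a ha ham
    have ht1 : 0 ≤ t 1 := by
      refine le_of_tendsto htl ?_
      filter_upwards [eventually_ge_atTop 1] with y hy
      exact hta.antitoneOn (show (0:ℝ) < 1 by linarith) (show (0:ℝ) < y by linarith) hy
    refine ⟨t 1 + 1 / a, by positivity, ?_⟩
    intro r hr
    have hmo := sp_mono (convex_Ioc (0:ℝ) 1) (f := fun r => t r - 1 / a * r ^ (-a))
      (f' := fun r => -(Real.sinh r ^ m)⁻¹ - 1 / a * (-a * r ^ (-a - 1)))
      (fun x hx => (htd x hx.1).sub ((Real.hasDerivAt_rpow_const (Or.inl hx.1.ne')).const_mul _))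
      (fun x hx => by
        have h2 : 1 / a * (-a * x ^ (-a - 1)) = - x ^ (-a - 1) := by field_simp
        have h3 : (Real.sinh x ^ m)⁻¹ ≤ (x ^ m)⁻¹ := by
          apply inv_anti₀ (pow_pos hx.1 m)
          gcongr
          · exact hx.1.le
          · exact Real.self_le_sinh_iff.mpr hx.1.le
        have h4 : (x ^ m)⁻¹ ≤ x ^ (-a - 1) := by
          rw [← Real.rpow_natCast, ← Real.rpow_neg hx.1.le]
          apply Real.rpow_le_rpow_of_exponent_ge hx.1 hx.2
          linarith
        rw [h2]
        linarith)
    have h1 := hmo hr ⟨one_pos, le_rfl⟩ hr.2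
    simp only [Real.one_rpow] at h1
    have h5 : 1 ≤ r ^ (-a) := Real.one_le_rpow_of_pos_of_le_one_of_nonpos hr.1 hr.2 (by linarith)
    have h6 : 0 < 1 / a := by positivity
    nlinarith

theorem sp_t_integrable (m : ℕ) (p a : ℝ) (hp : 1 < p) (hm : 1 ≤ m)
    (hap : a * (p + 1) / 2 < m + 1) (t : ℝ → ℝ) (htc : ContinuousOn t (Ioi 0))
    (htp : ∀ r > 0, 0 < t r)
    (h1 : ∃ C > 0, ∀ r ≥ 1, t r ≤ C * Real.exp (-(m : ℝ) * r))
    (h2 : ∃ C > 0, ∀ r ∈ Ioc (0:ℝ) 1, t r ≤ C * r ^ (-a)) :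
    IntegrableOn (fun r => |Real.sinh r| ^ m * (t r) ^ ((p + 1) / 2)) (Ioi 0) := by
  have hm0 : (0:ℝ) < m := by exact_mod_cast hm
  obtain ⟨C1, hC1, h1⟩ := h1
  obtain ⟨C2, hC2, h2⟩ := h2
  have hc : ContinuousOn (fun r => |Real.sinh r| ^ m * (t r) ^ ((p + 1) / 2)) (Ioi 0) := by
    apply ContinuousOn.mul
    · exact (Real.continuous_sinh.abs.pow m).continuousOn
    · exact htc.rpow_const (fun x hx => Or.inr (by linarith))
  rw [← Ioc_union_Ioi_eq_Ioi (zero_le_one : (0:ℝ) ≤ 1)]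
  apply IntegrableOn.union
  · have hi : IntegrableOn (fun r : ℝ => 2 ^ m * C2 ^ ((p + 1) / 2) * r ^ ((m : ℝ) - a * (p + 1) / 2))
        (Ioc 0 1) := by
      have := intervalIntegral.intervalIntegrable_rpow' (a := 0) (b := 1)
        (r := (m : ℝ) - a * (p + 1) / 2) (by linarith)
      rw [intervalIntegrable_iff_integrableOn_Ioc_of_le zero_le_one] at this
      exact this.const_mul _
    refine hi.mono' ((hc.mono (fun x hx => hx.1)).aestronglyMeasurable measurableSet_Ioc) ?_
    refine (ae_restrict_mem measurableSet_Ioc).mono (fun r hr => ?_)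
    have hs := Real.sinh_pos_iff.mpr hr.1
    have ht := htp r hr.1
    have hr0' : 0 < r := hr.1
    rw [Real.norm_of_nonneg (by positivity), abs_of_pos hs]
    calc Real.sinh r ^ m * t r ^ ((p + 1) / 2) ≤ (2 * r) ^ m * (C2 * r ^ (-a)) ^ ((p + 1) / 2) := by
          gcongr
          · exact sp_sinh_le_two hr.1.le hr.2
          · exact h2 r hr
      _ = _ := by
        have hr0 := hr.1
        rw [Real.mul_rpow hC2.le (by positivity), ← Real.rpow_mul hr0.le, mul_pow,
          ← Real.rpow_natCast r m]
        rw [show (m : ℝ) - a * (p + 1) / 2 = m + -a * ((p + 1) / 2) by ring, Real.rpow_add hr0]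
        ring
  · have hi : IntegrableOn (fun r : ℝ => C1 ^ ((p + 1) / 2) * Real.exp ((m * (1 - p) / 2) * r))
        (Ioi 1) := by
      apply Integrable.const_mul
      apply integrableOn_exp_mul_Ioi
      have : 0 < m * (p - 1) := mul_pos hm0 (by linarith)
      linarith
    refine hi.mono' ((hc.mono (Ioi_subset_Ioi zero_le_one)).aestronglyMeasurable
      measurableSet_Ioi) ?_
    refine (ae_restrict_mem measurableSet_Ioi).mono (fun r hr => ?_)
    have hr1 : 1 < r := hr
    have hr0 : 0 < r := by linarith
    have hs := Real.sinh_pos_iff.mpr hr0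
    have ht := htp r hr0
    rw [Real.norm_of_nonneg (by positivity), abs_of_pos hs]
    calc Real.sinh r ^ m * t r ^ ((p + 1) / 2) ≤
          (Real.exp r) ^ m * (C1 * Real.exp (-(m : ℝ) * r)) ^ ((p + 1) / 2) := by
          gcongr
          · exact sp_sinh_le
          · exact h1 r hr1.le
      _ = _ := by
        rw [Real.mul_rpow hC1.le (by positivity), ← Real.exp_mul, ← Real.exp_nat_mul,
          mul_left_comm, ← Real.exp_add]
        congr 2; ring

theorem sp_base (m : ℕ) (hm : 1 ≤ m) (p : ℝ) (hp : 1 < p) (hmp : ((m : ℝ) - 1) * (p - 1) < 4) :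
    ∃ V : ℝ → ℝ, (∀ r > 0, 0 < V r) ∧ ContinuousOn V (Ioi 0) ∧
      (∃ b > 0, b * (p + 1) < m + 1 ∧ b * (p - 1) < 2 ∧
        ∃ C > 0, ∀ r ∈ Ioc (0:ℝ) 1, V r ≤ C * r ^ (-b)) ∧
      (∃ C > 0, ∀ r ≥ 1, V r ≤ C * Real.exp (-((m : ℝ) / 2) * r)) ∧
      (∀ r > 0, IntervalIntegrable (fun s => Real.sinh s ^ m * V s ^ p) volume 0 r) ∧
      (∀ r > 0, HasDerivAt V
        (-((Real.sinh r ^ m)⁻¹ * ∫ s in (0:ℝ)..r, Real.sinh s ^ m * V s ^ p)) r) := by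
  have hm0 : (1:ℝ) ≤ m := by exact_mod_cast hm
  obtain ⟨a, ham, hap⟩ : ∃ a, max ((m : ℝ) - 1) 0 < a ∧
      a < min (2 * ((m : ℝ) + 1) / (p + 1)) (4 / (p - 1)) := by
    apply exists_between
    rw [lt_min_iff, max_lt_iff, max_lt_iff]
    have h1 : 0 < p - 1 := by linarith
    have h2 : 0 < p + 1 := by linarith
    refine ⟨⟨?_, by positivity⟩, ?_, by positivity⟩
    · rw [lt_div_iff₀ h2]; nlinarith
    · rw [lt_div_iff₀ h1]; exact hmp
  rw [max_lt_iff] at ham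
  rw [lt_min_iff, lt_div_iff₀ (by linarith), lt_div_iff₀ (by linarith)] at hap
  obtain ⟨t, htd, htp, hta, ht1, ht2⟩ := sp_t m hm
  have ht2 := ht2 a ham.2 ham.1.le
  have htc : ContinuousOn t (Ioi 0) := fun x hx => (htd x hx).continuousAt.continuousWithinAt
  have hint := sp_t_integrable m p a hp hm (by linarith [hap.1]) t htc htp ht1 ht2
  obtain ⟨V, hVp, hVc, ⟨C, hC, hVt⟩, hVI⟩ := sp_core (fun r => |Real.sinh r| ^ m) t p hp
    (fun r => by positivity)
    (fun r hr => by have := Real.sinh_pos_iff.mpr hr; positivity)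
    (Real.continuous_sinh.abs.pow m).continuousOn htc htp hta hint
  obtain ⟨C1, hC1, ht1⟩ := ht1
  obtain ⟨C2, hC2, ht2⟩ := ht2
  set F : ℝ → ℝ := fun s => Real.sinh s ^ m * V s ^ p with hF
  have hFc : ContinuousOn F (Ioi 0) := by
    apply ContinuousOn.mul
    · exact (Real.continuous_sinh.pow m).continuousOn
    · exact hVc.rpow_const (fun x hx => Or.inr (by linarith))
  have hF2 : ∀ ρ > 0, IntegrableOn (fun r => F r * t (max r ρ)) (Ioi 0) ∧
        V ρ = ∫ r in Ioi 0, F r * t (max r ρ) := by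
    intro ρ hρ
    obtain ⟨e1, e2⟩ := hVI ρ hρ
    have hcg : EqOn (fun r => |Real.sinh r| ^ m * V r ^ p * t (max r ρ))
        (fun r => F r * t (max r ρ)) (Ioi 0) := by
      intro r hr
      simp only [hF]
      rw [abs_of_pos (Real.sinh_pos_iff.mpr hr)]
    refine ⟨e1.congr_fun hcg measurableSet_Ioi, ?_⟩
    rw [← setIntegral_congr_fun measurableSet_Ioi hcg]
    exact e2
  have hFi : ∀ ρ > 0, IntegrableOn F (Ioc 0 ρ) := by
    intro ρ hρ
    have e1 := (hF2 ρ hρ).1.mono_set (Ioc_subset_Ioi_self : Ioc 0 ρ ⊆ Ioi 0)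
    have e2 := e1.mul_const (t ρ)⁻¹
    refine IntegrableOn.congr_fun e2 ?_ measurableSet_Ioc
    intro r hr
    simp only
    rw [max_eq_right hr.2, mul_inv_cancel_right₀ (htp ρ hρ).ne']
  have hFti : ∀ ρ > 0, IntegrableOn (fun r => F r * t r) (Ioi ρ) := by
    intro ρ hρ
    have e1 := (hF2 ρ hρ).1.mono_set (Ioi_subset_Ioi hρ.le)
    refine IntegrableOn.congr_fun e1 ?_ measurableSet_Ioi
    intro r hr
    simp only
    rw [max_eq_left (le_of_lt hr)]
  have hform : ∀ δ > 0, ∀ ρ > δ, V ρ = t ρ * (∫ s in (0:ℝ)..ρ, F s) +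
      ((∫ s in Ioi δ, F s * t s) - ∫ s in δ..ρ, F s * t s) := by
    intro δ hδ ρ hρδ
    have hρ : 0 < ρ := by linarith
    obtain ⟨e1, e2⟩ := hF2 ρ hρ
    rw [← Ioc_union_Ioi_eq_Ioi hρ.le, setIntegral_union (Ioc_disjoint_Ioi le_rfl) measurableSet_Ioi
      (e1.mono_set Ioc_subset_Ioi_self) (e1.mono_set (Ioi_subset_Ioi hρ.le))] at e2
    have e3 : ∫ r in Ioc 0 ρ, F r * t (max r ρ) = t ρ * (∫ s in (0:ℝ)..ρ, F s) := by
      rw [intervalIntegral.integral_of_le hρ.le, mul_comm, ← integral_mul_const]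
      apply setIntegral_congr_fun measurableSet_Ioc
      intro r hr
      simp only
      rw [max_eq_right hr.2]
    have e4 : ∫ r in Ioi ρ, F r * t (max r ρ) = ∫ r in Ioi ρ, F r * t r := by
      apply setIntegral_congr_fun measurableSet_Ioi
      intro r hr
      simp only
      rw [max_eq_left (le_of_lt hr)]
    have e5 : ∫ s in Ioi δ, F s * t s = (∫ s in δ..ρ, F s * t s) + ∫ r in Ioi ρ, F r * t r := by
      rw [intervalIntegral.integral_of_le hρδ.le, ← Ioc_union_Ioi_eq_Ioi hρδ.le,
        setIntegral_union (Ioc_disjoint_Ioi le_rfl) measurableSet_Ioi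
        ((hFti δ hδ).mono_set Ioc_subset_Ioi_self) (hFti ρ hρ)]
    rw [e2, e3, e4, e5]; ring
  have hsqrt : ∀ r > 0, ∀ C' > 0, ∀ x > 0, t r ≤ C' * x → V r ≤ (C * C' ^ ((1:ℝ)/2)) * x ^ ((1:ℝ)/2) := by
    intro r hr C' hC' x hx h
    refine (hVt r hr).trans ?_
    rw [mul_assoc]
    apply mul_le_mul_of_nonneg_left _ hC.le
    rw [← Real.mul_rpow hC'.le hx.le]
    exact Real.rpow_le_rpow (htp r hr).le h (by norm_num)
  refine ⟨V, hVp, hVc, ⟨a / 2, by linarith, by linarith [hap.1], by linarith [hap.2],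
    C * C2 ^ ((1:ℝ)/2), by positivity, ?_⟩, ⟨C * C1 ^ ((1:ℝ)/2), by positivity, ?_⟩, ?_, ?_⟩
  · intro r hr
    have hr0 := hr.1
    have := hsqrt r hr.1 C2 hC2 (r ^ (-a)) (by positivity) (ht2 r hr)
    rw [← Real.rpow_mul hr.1.le] at this
    convert this using 3; ring
  · intro r hr
    have := hsqrt r (by linarith) C1 hC1 (Real.exp (-(m : ℝ) * r)) (by positivity) (ht1 r hr)
    rw [← Real.exp_mul] at this
    convert this using 3; ring
  · intro r hr
    rw [intervalIntegrable_iff_integrableOn_Ioc_of_le hr.le]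
    exact hFi r hr
  · intro r hr
    set δ := r / 2 with hδ
    have hδ0 : 0 < δ := by positivity
    have hδr : δ < r := by linarith
    have hFtc : ContinuousOn (fun s => F s * t s) (Ioi 0) := hFc.mul htc
    have d1 : HasDerivAt (fun u => ∫ s in (0:ℝ)..u, F s) (F r) r := by
      apply intervalIntegral.integral_hasDerivAt_right
      · rw [intervalIntegrable_iff_integrableOn_Ioc_of_le hr.le]
        exact hFi r hr
      · exact hFc.stronglyMeasurableAtFilter isOpen_Ioi r hr
      · exact hFc.continuousAt (Ioi_mem_nhds hr)
    have d2 : HasDerivAt (fun u => ∫ s in δ..u, F s * t s) (F r * t r) r := by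
      apply intervalIntegral.integral_hasDerivAt_right
      · rw [intervalIntegrable_iff_integrableOn_Ioc_of_le hδr.le]
        exact (hFti δ hδ0).mono_set Ioc_subset_Ioi_self
      · exact hFtc.stronglyMeasurableAtFilter isOpen_Ioi r hr
      · exact hFtc.continuousAt (Ioi_mem_nhds hr)
    have d3 := ((htd r hr).mul d1).add (d2.const_sub (∫ s in Ioi δ, F s * t s))
    have hev : V =ᶠ[𝓝 r] ((t * fun u => ∫ s in (0:ℝ)..u, F s) +
        fun u => (∫ s in Ioi δ, F s * t s) - ∫ s in δ..u, F s * t s) := by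
      filter_upwards [Ioi_mem_nhds hδr] with u hu
      simp only [Pi.add_apply, Pi.mul_apply]
      exact hform δ hδ0 u hu
    refine (d3.congr_of_eventuallyEq hev).congr_deriv ?_
    ring


theorem sp_g_deriv (m : ℕ) (p : ℝ) (hp : 1 < p) (V : ℝ → ℝ) (hVc : ContinuousOn V (Ioi 0))
    (hVi : ∀ r > 0, IntervalIntegrable (fun s => Real.sinh s ^ m * V s ^ p) volume 0 r) :
    ∀ r > 0, HasDerivAt (fun r => ∫ s in (0:ℝ)..r, Real.sinh s ^ m * V s ^ p)
      (Real.sinh r ^ m * V r ^ p) r := by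
  intro r hr
  have hFc : ContinuousOn (fun s => Real.sinh s ^ m * V s ^ p) (Ioi 0) := by
    apply ContinuousOn.mul
    · exact (Real.continuous_sinh.pow m).continuousOn
    · exact hVc.rpow_const (fun x hx => Or.inr (by linarith))
  exact intervalIntegral.integral_hasDerivAt_right (hVi r hr)
    (hFc.stronglyMeasurableAtFilter isOpen_Ioi r hr) (hFc.continuousAt (Ioi_mem_nhds hr))

theorem sp_g_nonneg (m : ℕ) (p : ℝ) (V : ℝ → ℝ) (hVp : ∀ r > 0, 0 < V r) (r : ℝ) (hr : 0 ≤ r) :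
    0 ≤ ∫ s in (0:ℝ)..r, Real.sinh s ^ m * V s ^ p := by
  rw [intervalIntegral.integral_of_le hr]
  apply setIntegral_nonneg measurableSet_Ioc
  intro s hs
  have := Real.sinh_pos_iff.mpr hs.1
  have := hVp s hs.1
  positivity

theorem sp_zero_step (m : ℕ) (p : ℝ) (hp : 1 < p) (V : ℝ → ℝ) (hVp : ∀ r > 0, 0 < V r)
    (hVi : ∀ r > 0, IntervalIntegrable (fun s => Real.sinh s ^ m * V s ^ p) volume 0 r)
    (hVd : ∀ r > 0, HasDerivAt V
        (-((Real.sinh r ^ m)⁻¹ * ∫ s in (0:ℝ)..r, Real.sinh s ^ m * V s ^ p)) r)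
    (b b' : ℝ) (hb : b * p < m + 1) (hb0 : b' ≠ 0) (hbb : b * p - 2 ≤ b')
    (h : ∃ C > 0, ∀ r ∈ Ioc (0:ℝ) 1, V r ≤ C * r ^ (-b)) :
    ∃ D > 0, ∀ r ∈ Ioc (0:ℝ) 1, V r ≤ V 1 + D / b' * (r ^ (-b') - 1) := by
  obtain ⟨C, hC, hV⟩ := h
  set e := (m : ℝ) - b * p with he
  have he1 : 0 < e + 1 := by linarith
  set D := 2 ^ m * C ^ p / (e + 1) with hD
  have hD0 : 0 < D := by positivity
  have hg : ∀ r ∈ Ioc (0:ℝ) 1, ∫ s in (0:ℝ)..r, Real.sinh s ^ m * V s ^ p ≤ D * r ^ (e + 1) := by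
    intro r hr
    have hii : IntervalIntegrable (fun s : ℝ => 2 ^ m * C ^ p * s ^ e) volume 0 r :=
      (intervalIntegral.intervalIntegrable_rpow' (by linarith)).const_mul _
    have h1 := intervalIntegral.integral_mono_on_of_le_Ioo hr.1.le (hVi r hr.1) hii
      (fun s hs => by
        have hs0 : 0 < s := hs.1
        have hs1 : s ≤ 1 := by linarith [hs.2, hr.2]
        have hsh := Real.sinh_pos_iff.mpr hs0
        have hVs := hVp s hs0
        calc Real.sinh s ^ m * V s ^ p ≤ (2 * s) ^ m * (C * s ^ (-b)) ^ p := by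
              gcongr
              · exact sp_sinh_le_two hs0.le hs1
              · exact hV s ⟨hs0, hs1⟩
          _ = 2 ^ m * C ^ p * s ^ e := by
            rw [Real.mul_rpow hC.le (by positivity), ← Real.rpow_mul hs0.le, mul_pow,
              ← Real.rpow_natCast s m, he,
              show (m : ℝ) - b * p = m + -b * p by ring, Real.rpow_add hs0]
            ring)
    refine h1.trans (le_of_eq ?_)
    rw [intervalIntegral.integral_const_mul, integral_rpow (Or.inl (by linarith)),
      Real.zero_rpow he1.ne', hD]
    ring
  refine ⟨D, hD0, ?_⟩
  intro r hr
  have hmo := sp_mono (convex_Ioc (0:ℝ) 1) (f := fun r => V r - D / b' * r ^ (-b'))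
      (f' := fun r => -((Real.sinh r ^ m)⁻¹ * ∫ s in (0:ℝ)..r, Real.sinh s ^ m * V s ^ p)
        - D / b' * (-b' * r ^ (-b' - 1)))
      (fun x hx => (hVd x hx.1).sub ((Real.hasDerivAt_rpow_const (Or.inl hx.1.ne')).const_mul _))
      (fun x hx => by
        have hx0 : 0 < x := hx.1
        have h2 : D / b' * (-b' * x ^ (-b' - 1)) = - (D * x ^ (-b' - 1)) := by field_simp
        have h3 : (Real.sinh x ^ m)⁻¹ ≤ (x ^ m)⁻¹ := by
          apply inv_anti₀ (pow_pos hx.1 m)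
          gcongr
          exact Real.self_le_sinh_iff.mpr hx.1.le
        have h4 : x ^ (e + 1 - m) ≤ x ^ (-b' - 1) := by
          apply Real.rpow_le_rpow_of_exponent_ge hx.1 hx.2
          linarith
        have h5 : (Real.sinh x ^ m)⁻¹ * ∫ s in (0:ℝ)..x, Real.sinh s ^ m * V s ^ p ≤
            (x ^ m)⁻¹ * (D * x ^ (e + 1)) :=
          mul_le_mul h3 (hg x hx) (sp_g_nonneg m p V hVp x hx0.le) (by positivity)
        have h6 : (x ^ m)⁻¹ * (D * x ^ (e + 1)) = D * x ^ (e + 1 - m) := by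
          rw [Real.rpow_sub hx0, Real.rpow_natCast]; ring
        have h7 : D * x ^ (e + 1 - m) ≤ D * x ^ (-b' - 1) := by gcongr
        rw [h2]
        linarith)
  have h1 := hmo hr ⟨one_pos, le_rfl⟩ hr.2
  simp only [Real.one_rpow] at h1
  linarith

theorem sp_zero_bdd (m : ℕ) (p : ℝ) (hp : 1 < p) (V : ℝ → ℝ) (hVp : ∀ r > 0, 0 < V r)
    (hVi : ∀ r > 0, IntervalIntegrable (fun s => Real.sinh s ^ m * V s ^ p) volume 0 r)
    (hVd : ∀ r > 0, HasDerivAt V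
        (-((Real.sinh r ^ m)⁻¹ * ∫ s in (0:ℝ)..r, Real.sinh s ^ m * V s ^ p)) r)
    (h : ∃ b > 0, b * (p + 1) < m + 1 ∧ b * (p - 1) < 2 ∧
        ∃ C > 0, ∀ r ∈ Ioc (0:ℝ) 1, V r ≤ C * r ^ (-b)) :
    ∃ C > 0, ∀ r ∈ Ioc (0:ℝ) 1, V r ≤ C := by
  obtain ⟨b0, hb0, hb1, hb2, h⟩ := h
  have hp0 : 0 < p := by linarith
  set δ := 2 - b0 * (p - 1) with hδ
  have hδ0 : 0 < δ := by linarith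
  set ε := min b0 (1 / p) with hε
  have hε0 : 0 < ε := lt_min hb0 (by positivity)
  have hεb : ε ≤ b0 := min_le_left _ _
  have hεp : ε * p ≤ 1 := by
    have : ε ≤ 1 / p := min_le_right _ _
    rwa [le_div_iff₀ hp0] at this
  have hV1 := hVp 1 one_pos
  have hit : ∀ n : ℕ, ∃ C > 0, ∀ r ∈ Ioc (0:ℝ) 1, V r ≤ C * r ^ (-(max (b0 - n * δ) ε)) := by
    intro n
    induction n with
    | zero =>
      simpa [max_eq_left hεb] using h
    | succ n ih =>
      set b := max (b0 - n * δ) ε with hb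
      set b' := max (b0 - ((n + 1 : ℕ) : ℝ) * δ) ε with hb'
      have hbp : 0 < b := lt_max_of_lt_right hε0
      have hb'p : 0 < b' := lt_max_of_lt_right hε0
      have hbb0 : b ≤ b0 := by
        apply max_le _ hεb
        have : 0 ≤ n * δ := by positivity
        linarith
      have hbd : b - δ ≤ b' := by
        have : b ≤ b' + δ := by
          apply max_le
          · have := le_max_left (b0 - ((n + 1 : ℕ) : ℝ) * δ) ε
            push_cast at this
            push_cast at hb'
            rw [← hb'] at this
            linarith
          · have := le_max_right (b0 - ((n + 1 : ℕ) : ℝ) * δ) ε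
            linarith
        linarith
      have h1 : b * (p - 1) ≤ b0 * (p - 1) := mul_le_mul_of_nonneg_right hbb0 (by linarith)
      have h2 : b * p ≤ b0 * p := mul_le_mul_of_nonneg_right hbb0 (by linarith)
      obtain ⟨D, hD, hs⟩ := sp_zero_step m p hp V hVp hVi hVd b b' (by linarith) hb'p.ne'
        (by linarith) ih
      refine ⟨V 1 + D / b', by positivity, fun r hr => (hs r hr).trans ?_⟩
      have h5 : 1 ≤ r ^ (-b') := Real.one_le_rpow_of_pos_of_le_one_of_nonpos hr.1 hr.2 (by linarith)
      have h6 : 0 < D / b' := by positivity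
      nlinarith
  obtain ⟨n, hn⟩ := exists_nat_ge (b0 / δ)
  rw [div_le_iff₀ hδ0] at hn
  have h1 := hit n
  rw [max_eq_right (by linarith)] at h1
  have h2 : ε * p ≤ b0 * p := mul_le_mul_of_nonneg_right hεb (by linarith)
  obtain ⟨D, hD, hs⟩ := sp_zero_step m p hp V hVp hVi hVd ε (-1) (by linarith) (by norm_num)
        (by linarith) h1
  refine ⟨V 1 + D, by positivity, fun r hr => (hs r hr).trans ?_⟩
  rw [neg_neg, Real.rpow_one]
  have := hr.1
  rw [div_neg, div_one]
  nlinarith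

theorem sp_inf_step (m : ℕ) (p : ℝ) (hp : 1 < p) (V : ℝ → ℝ) (hVp : ∀ r > 0, 0 < V r)
    (hVc : ContinuousOn V (Ioi 0))
    (hVi : ∀ r > 0, IntervalIntegrable (fun s => Real.sinh s ^ m * V s ^ p) volume 0 r)
    (hVd : ∀ r > 0, HasDerivAt V
        (-((Real.sinh r ^ m)⁻¹ * ∫ s in (0:ℝ)..r, Real.sinh s ^ m * V s ^ p)) r)
    (β γ β' : ℝ) (hβ : 0 < β) (hγ0 : γ ≠ 0) (hγ : m - p * β ≤ γ) (hβ' : β' = m - max γ 0)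
    (hβ'0 : 0 < β')
    (h : ∃ C > 0, ∀ r ≥ 1, V r ≤ C * Real.exp (-β * r)) :
    (∃ C > 0, ∀ r ≥ 1, V r ≤ C * Real.exp (-β' * r)) ∧
    (∃ D > 0, ∀ r ≥ 1, ∫ s in (0:ℝ)..r, Real.sinh s ^ m * V s ^ p ≤ D * Real.exp (max γ 0 * r)) := by
  obtain ⟨C, hC, hV⟩ := h
  set g : ℝ → ℝ := fun r => ∫ s in (0:ℝ)..r, Real.sinh s ^ m * V s ^ p with hg
  have hgd := sp_g_deriv m p hp V hVc hVi
  have hg1 : 0 ≤ g 1 := sp_g_nonneg m p V hVp 1 zero_le_one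
  set D := g 1 + C ^ p / |γ| with hD
  have hγa : 0 < |γ| := abs_pos.mpr hγ0
  have hD0 : 0 < D := by positivity
  have hgle : ∀ r ≥ 1, g r ≤ D * Real.exp (max γ 0 * r) := by
    intro r hr
    have hmo := sp_mono (convex_Ici (1:ℝ)) (f := fun r => C ^ p / γ * Real.exp (γ * r) - g r)
      (f' := fun r => C ^ p / γ * (γ * Real.exp (γ * r)) - Real.sinh r ^ m * V r ^ p)
      (fun x hx => ((sp_expo_deriv γ x).const_mul _).sub (hgd x (lt_of_lt_of_le one_pos hx)))
      (fun x hx => by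
        have hx1 : (1:ℝ) ≤ x := hx
        have hx0 : 0 < x := by linarith
        have hsh := Real.sinh_pos_iff.mpr hx0
        have hVs := hVp x hx0
        have h2 : C ^ p / γ * (γ * Real.exp (γ * x)) = C ^ p * Real.exp (γ * x) := by field_simp
        have h3 : Real.sinh x ^ m * V x ^ p ≤ C ^ p * Real.exp (γ * x) := by
          calc Real.sinh x ^ m * V x ^ p ≤ (Real.exp x) ^ m * (C * Real.exp (-β * x)) ^ p := by
                gcongr
                · exact sp_sinh_le
                · exact hV x hx1
            _ = C ^ p * Real.exp ((m - p * β) * x) := by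
              rw [Real.mul_rpow hC.le (by positivity), ← Real.exp_mul, ← Real.exp_nat_mul,
                mul_left_comm, ← Real.exp_add]
              congr 2; ring
            _ ≤ C ^ p * Real.exp (γ * x) := by gcongr
        rw [h2]
        linarith)
    have h1 := hmo (mem_Ici.mpr le_rfl) (show r ∈ Ici 1 from hr) hr
    simp only at h1
    have hE : 1 ≤ Real.exp (max γ 0 * r) := by
      apply Real.one_le_exp
      apply mul_nonneg (le_max_right _ _); linarith
    have hCp : 0 < C ^ p := by positivity
    rcases lt_or_gt_of_ne hγ0 with hn | hn
    · have h2 : C ^ p / |γ| = -(C ^ p / γ) := by rw [abs_of_neg hn, div_neg]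
      have h3 : C ^ p / γ * Real.exp (γ * r) ≤ 0 :=
        mul_nonpos_of_nonpos_of_nonneg (div_nonpos_of_nonneg_of_nonpos hCp.le hn.le) (by positivity)
      have h4 : Real.exp (γ * 1) ≤ 1 := by rw [Real.exp_le_one_iff]; linarith
      have h5 : 0 < C ^ p / |γ| := by positivity
      have h6 : g r ≤ D := by
        rw [hD]
        nlinarith
      nlinarith
    · rw [max_eq_left hn.le] at hE ⊢
      have h2 : C ^ p / |γ| = C ^ p / γ := by rw [abs_of_pos hn]
      have h3 : 0 < C ^ p / γ * Real.exp (γ * 1) := by positivity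
      rw [hD, h2]
      nlinarith
  refine ⟨⟨D * 4 ^ m / β', by positivity, ?_⟩, D, hD0, hgle⟩
  intro r hr
  have hlim : Tendsto V atTop (𝓝 0) := by
    have hl0 : Tendsto (fun x => C * Real.exp (-β * x)) atTop (𝓝 0) := by
      have := (sp_expo_tendsto (c := -β) (by linarith)).const_mul C
      rwa [mul_zero] at this
    refine squeeze_zero' ?_ ?_ hl0
    · filter_upwards [eventually_gt_atTop 0] with x hx using (hVp x hx).le
    · filter_upwards [eventually_ge_atTop 1] with x hx using hV x hx
  have := sp_le_zero (a := 1) (f := fun r => V r - D * 4 ^ m / β' * Real.exp (-β' * r))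
      (f' := fun r => -((Real.sinh r ^ m)⁻¹ * g r) - D * 4 ^ m / β' * (-β' * Real.exp (-β' * r)))
      (fun x hx => (hVd x (lt_of_lt_of_le one_pos hx)).sub ((sp_expo_deriv _ x).const_mul _))
      (fun x hx => by
        have hx1 : (1:ℝ) ≤ x := hx
        have h1 := sp_inv_le (m := m) hx
        have h2 : D * 4 ^ m / β' * (-β' * Real.exp (-β' * x)) =
          -(D * 4 ^ m * Real.exp (-β' * x)) := by field_simp
        have h3 : (Real.sinh x ^ m)⁻¹ * g x ≤
            4 ^ m * Real.exp (-(m : ℝ) * x) * (D * Real.exp (max γ 0 * x)) :=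
          mul_le_mul h1 (hgle x hx1) (sp_g_nonneg m p V hVp x (by linarith)) (by positivity)
        have h4 : 4 ^ m * Real.exp (-(m : ℝ) * x) * (D * Real.exp (max γ 0 * x)) =
            D * 4 ^ m * Real.exp (-β' * x) := by
          rw [hβ', show -((m : ℝ) - max γ 0) * x = -(m : ℝ) * x + max γ 0 * x by ring, Real.exp_add]
          ring
        rw [h2]
        linarith)
      (by simpa using hlim.sub ((sp_expo_tendsto (c := -β') (by linarith)).const_mul _)) r hr
  linarith

theorem sp_inf_bdd (m : ℕ) (hm : 1 ≤ m) (p : ℝ) (hp : 1 < p) (V : ℝ → ℝ) (hVp : ∀ r > 0, 0 < V r)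
    (hVc : ContinuousOn V (Ioi 0))
    (hVi : ∀ r > 0, IntervalIntegrable (fun s => Real.sinh s ^ m * V s ^ p) volume 0 r)
    (hVd : ∀ r > 0, HasDerivAt V
        (-((Real.sinh r ^ m)⁻¹ * ∫ s in (0:ℝ)..r, Real.sinh s ^ m * V s ^ p)) r)
    (h : ∃ C > 0, ∀ r ≥ 1, V r ≤ C * Real.exp (-((m : ℝ) / 2) * r)) :
    (∃ C > 0, ∀ r ≥ 1, V r ≤ C * Real.exp (-(m : ℝ) * r)) ∧
    (∃ D > 0, ∀ r ≥ 1, ∫ s in (0:ℝ)..r, Real.sinh s ^ m * V s ^ p ≤ D) := by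
  have hm0 : (1:ℝ) ≤ m := by exact_mod_cast hm
  have hp0 : 0 < p := by linarith
  obtain ⟨β1, hβ1, hβ1m⟩ : ∃ β1 : ℝ, max ((m : ℝ) / 2) (m / p) < β1 ∧ β1 < m := by
    apply exists_between
    apply max_lt
    · linarith
    · rw [div_lt_iff₀ hp0]; nlinarith
  rw [max_lt_iff, div_lt_iff₀ hp0] at hβ1
  set δ := (p - 1) * (m / 2) with hδ
  have hδ0 : 0 < δ := by
    have : 0 < p - 1 := by linarith
    positivity
  have hit : ∀ n : ℕ, ∃ C > 0, ∀ r ≥ 1, V r ≤ C * Real.exp (-(min (m / 2 + n * δ) β1) * r) := by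
    intro n
    induction n with
    | zero => simpa [min_eq_left hβ1.1.le] using h
    | succ n ih =>
      set β := min ((m : ℝ) / 2 + n * δ) β1 with hβ
      set β' := min ((m : ℝ) / 2 + ((n + 1 : ℕ) : ℝ) * δ) β1 with hβ'
      have hnδ : 0 ≤ n * δ := by positivity
      have hβ0 : (m : ℝ) / 2 ≤ β := le_min (by linarith) hβ1.1.le
      have hβ'0 : (m : ℝ) / 2 ≤ β' := by
        apply le_min _ hβ1.1.le
        have : 0 ≤ ((n + 1 : ℕ) : ℝ) * δ := by positivity
        linarith
      have hβ'1 : β' ≤ β1 := min_le_right _ _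
      have hββ : β' - δ ≤ β := by
        apply le_min
        · have := min_le_left ((m : ℝ) / 2 + ((n + 1 : ℕ) : ℝ) * δ) β1
          rw [← hβ'] at this
          push_cast at this
          linarith
        · linarith
      have h1 : (p - 1) * (m / 2) ≤ (p - 1) * β := mul_le_mul_of_nonneg_left hβ0 (by linarith)
      exact (sp_inf_step m p hp V hVp hVc hVi hVd β (m - β') β' (by linarith) (by linarith)
        (by linarith) (by rw [max_eq_left (by linarith)]; ring) (by linarith) ih).1
  obtain ⟨n, hn⟩ := exists_nat_ge (m / δ)
  rw [div_le_iff₀ hδ0] at hn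
  have h1 := hit n
  rw [min_eq_right (by linarith)] at h1
  have hneg : m - p * β1 < 0 := by linarith
  have h2 := sp_inf_step m p hp V hVp hVc hVi hVd β1 (m - p * β1) m (by linarith) hneg.ne
        le_rfl (by rw [max_eq_right hneg.le]; ring) (by linarith) h1
  rw [max_eq_right hneg.le] at h2
  simpa using h2


theorem sp_F_cont (n : ℕ) (h : ℝ → ℝ) (hh : Continuous h) :
    Continuous (fun r : ℝ => ∫ τ in (0:ℝ)..1, τ ^ n * h (r * τ)) := by
  apply intervalIntegral.continuous_parametric_intervalIntegral_of_continuous'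
  simp only [Function.uncurry_def]
  fun_prop

theorem sp_F_deriv (n : ℕ) (h : ℝ → ℝ) (hh : ContDiff ℝ 1 h) (r : ℝ) :
    HasDerivAt (fun r : ℝ => ∫ τ in (0:ℝ)..1, τ ^ n * h (r * τ))
      (∫ τ in (0:ℝ)..1, τ ^ (n + 1) * deriv h (r * τ)) r := by
  have hc : Continuous h := hh.continuous
  have hc' : Continuous (deriv h) := hh.continuous_deriv le_rfl
  obtain ⟨M, hM⟩ := (isCompact_Icc (a := -(|r| + 1)) (b := |r| + 1)).exists_bound_of_continuousOn
    hc'.continuousOn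
  refine (intervalIntegral.hasDerivAt_integral_of_dominated_loc_of_deriv_le
    (s := Metric.ball r 1) (bound := fun _ => M)
    (F := fun r τ => τ ^ n * h (r * τ)) (F' := fun r τ => τ ^ (n + 1) * deriv h (r * τ))
    (Metric.ball_mem_nhds r one_pos) ?_ ?_ ?_ ?_ ?_ ?_).2
  · refine Eventually.of_forall fun x => Continuous.aestronglyMeasurable ?_
    fun_prop
  · apply Continuous.intervalIntegrable
    fun_prop
  · apply Continuous.aestronglyMeasurable
    fun_prop
  · refine Eventually.of_forall fun t ht x hx => ?_
    rw [uIoc_of_le zero_le_one] at ht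
    rw [Metric.mem_ball, Real.dist_eq] at hx
    have hx2 : |x| ≤ |r| + 1 := by
      have := abs_sub_abs_le_abs_sub x r
      linarith
    have ht1 : |t| ≤ 1 := by rw [abs_of_pos ht.1]; exact ht.2
    have h1 : |x * t| ≤ |r| + 1 := by
      rw [abs_mul]
      nlinarith [abs_nonneg x, abs_nonneg t]
    have h2 := hM (x * t) (abs_le.mp h1)
    rw [norm_mul, norm_pow, Real.norm_eq_abs]
    have h3 : |t| ^ (n + 1) ≤ 1 := pow_le_one₀ (abs_nonneg t) ht1
    have h4 : 0 ≤ ‖deriv h (x * t)‖ := norm_nonneg _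
    nlinarith
  · simp
  · refine Eventually.of_forall fun t ht x hx => ?_
    have h1 : HasDerivAt h (deriv h (x * t)) (x * t) :=
      (hh.differentiable one_ne_zero (x * t)).hasDerivAt
    have h2 := (h1.comp x ((hasDerivAt_id x).mul_const t)).const_mul (t ^ n)
    exact h2.congr_deriv (by ring)

theorem sp_F_contDiff (k : ℕ) : ∀ (n : ℕ) (h : ℝ → ℝ), ContDiff ℝ k h →
    ContDiff ℝ k (fun r : ℝ => ∫ τ in (0:ℝ)..1, τ ^ n * h (r * τ)) := by
  induction k with
  | zero =>
    intro n h hh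
    have := sp_F_cont n h hh.continuous
    exact contDiff_zero.mpr this
  | succ k ih =>
    intro n h hh
    have h1 : ContDiff ℝ 1 h := hh.of_le (by exact_mod_cast Nat.le_add_left 1 k)
    push_cast at hh ⊢
    rw [contDiff_succ_iff_deriv] at hh ⊢
    refine ⟨fun r => (sp_F_deriv n h h1 r).differentiableAt, by simp, ?_⟩
    have : deriv (fun r : ℝ => ∫ τ in (0:ℝ)..1, τ ^ n * h (r * τ)) =
      (fun r : ℝ => ∫ τ in (0:ℝ)..1, τ ^ (n + 1) * deriv h (r * τ)) :=
      funext fun r => (sp_F_deriv n h h1 r).deriv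
    rw [this]
    exact ih (n + 1) _ hh.2.2

noncomputable def spPhi (r : ℝ) : ℝ := ∫ τ in (0:ℝ)..1, τ ^ 0 * Real.cosh (r * τ)

theorem spPhi_contDiff (k : ℕ) : ContDiff ℝ k spPhi :=
  sp_F_contDiff k 0 _ Real.contDiff_cosh

theorem spPhi_even (r : ℝ) : spPhi (-r) = spPhi r := by
  simp [spPhi]

theorem spPhi_pos (r : ℝ) : 0 < spPhi r := by
  unfold spPhi
  apply intervalIntegral.intervalIntegral_pos_of_pos
  · apply Continuous.intervalIntegrable
    have := Real.continuous_cosh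
    fun_prop
  · intro x
    have := Real.cosh_pos (r * x)
    simpa
  · norm_num

theorem spPhi_mul (r : ℝ) : r * spPhi r = Real.sinh r := by
  unfold spPhi
  have : ∀ τ : ℝ, τ ^ 0 * Real.cosh (r * τ) = Real.cosh (r * τ) := by simp
  simp_rw [this]
  rw [intervalIntegral.mul_integral_comp_mul_left, intervalIntegral.integral_eq_sub_of_hasDerivAt
    (f := Real.sinh) (fun x _ => Real.hasDerivAt_sinh x)
    (Real.continuous_cosh.intervalIntegrable _ _)]
  simp

noncomputable def spS (m : ℕ) (u : ℝ → ℝ) (r : ℝ) : ℝ :=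
  r * (spPhi r ^ m)⁻¹ * ∫ τ in (0:ℝ)..1, τ ^ m * (spPhi (r * τ) ^ m * u (r * τ))

theorem spS_contDiff (m k : ℕ) (u : ℝ → ℝ) (hu : ContDiff ℝ k u) : ContDiff ℝ k (spS m u) := by
  have h1 := (spPhi_contDiff k).pow m
  have h2 := sp_F_contDiff k m _ (h1.mul hu)
  have h3 := h1.inv (fun x => (pow_pos (spPhi_pos x) m).ne')
  exact (contDiff_id.mul h3).mul h2

theorem spS_odd (m : ℕ) (u : ℝ → ℝ) (hu : ∀ x, u (-x) = u x) (r : ℝ) : spS m u (-r) = - spS m u r := by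
  unfold spS
  simp only [spPhi_even, neg_mul, hu]

theorem spS_eq (m : ℕ) (u : ℝ → ℝ) (r : ℝ) (hr : 0 < r) :
    spS m u r = (Real.sinh r ^ m)⁻¹ * ∫ s in (0:ℝ)..r, Real.sinh s ^ m * u s := by
  have h := intervalIntegral.mul_integral_comp_mul_left (a := 0) (b := 1)
    (f := fun s => Real.sinh s ^ m * u s) r
  rw [mul_zero, mul_one] at h
  rw [← h]
  have h2 : ∀ τ : ℝ, Real.sinh (r * τ) ^ m * u (r * τ) =
      r ^ m * (τ ^ m * (spPhi (r * τ) ^ m * u (r * τ))) := by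
    intro τ
    rw [← spPhi_mul (r * τ)]
    ring
  simp_rw [h2]
  rw [intervalIntegral.integral_const_mul, ← spPhi_mul r]
  unfold spS
  have := (spPhi_pos r).ne'
  rw [mul_pow]
  field_simp

theorem sp_smooth (m : ℕ) (p : ℝ) (hp : 1 < p) (V : ℝ → ℝ) (hVp : ∀ r > 0, 0 < V r)
    (hVc : ContinuousOn V (Ioi 0))
    (hVd : ∀ r > 0, HasDerivAt V
        (-((Real.sinh r ^ m)⁻¹ * ∫ s in (0:ℝ)..r, Real.sinh s ^ m * V s ^ p)) r)
    (hb : ∃ C > 0, ∀ r ∈ Ioc (0:ℝ) 1, V r ≤ C) :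
    ∃ W : ℝ → ℝ, (∀ r > 0, W r = V r) ∧ (∀ r, 0 < W r) ∧ (∀ k : ℕ, ContDiff ℝ k W) ∧
      deriv W 0 = 0 := by
  obtain ⟨C, hC, hb⟩ := hb
  have hanti : AntitoneOn V (Ioi 0) := by
    intro x hx y hy hxy
    have := sp_mono (convex_Ioi (0:ℝ)) (f := fun r => - V r) (fun r hr => (hVd r hr).neg)
      (fun r hr => by
        rw [neg_neg]
        have := Real.sinh_pos_iff.mpr hr
        exact mul_nonneg (by positivity) (sp_g_nonneg m p V hVp r (le_of_lt hr))) hx hy hxy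
    simp only at this
    linarith
  set L := sSup (V '' Ioo 0 1) with hL
  have hbdd : BddAbove (V '' Ioo 0 1) :=
    ⟨C, by rintro _ ⟨x, hx, rfl⟩; exact hb x ⟨hx.1, hx.2.le⟩⟩
  have hlim : Tendsto V (𝓝[>] 0) (𝓝 L) :=
    AntitoneOn.tendsto_nhdsWithin_Ioo_right (nonempty_Ioo.mpr one_pos)
      (hanti.mono Ioo_subset_Ioi_self) hbdd
  have hL0 : 0 < L := lt_of_lt_of_le (hVp (1/2) (by norm_num))
    (le_csSup hbdd ⟨1/2, by norm_num, rfl⟩)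
  set W : ℝ → ℝ := fun r => if r = 0 then L else V |r| with hW
  have hWV : ∀ r > 0, W r = V r := by
    intro r hr
    simp [hW, hr.ne', abs_of_pos hr]
  have hW0 : W 0 = L := by simp [hW]
  have hWe : ∀ r, W (-r) = W r := by
    intro r
    simp [hW]
  have hWp : ∀ r, 0 < W r := by
    intro r
    rcases eq_or_ne r 0 with rfl | hr
    · rw [hW0]; exact hL0
    · simp only [hW, hr, if_false]
      exact hVp _ (abs_pos.mpr hr)
  set u : ℝ → ℝ := fun r => W r ^ p with hu
  have hue : ∀ r, u (-r) = u r := by intro r; simp only [hu, hWe]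
  have hd0 : ∀ r > 0, HasDerivAt W (-(spS m u r)) r := by
    intro r hr
    have h1 : W =ᶠ[𝓝 r] V := by
      filter_upwards [lt_mem_nhds hr] with x hx using hWV x hx
    refine (HasDerivAt.congr_of_eventuallyEq ?_ h1)
    rw [spS_eq m u r hr]
    suffices h7 : ∫ s in (0:ℝ)..r, Real.sinh s ^ m * V s ^ p =
        ∫ s in (0:ℝ)..r, Real.sinh s ^ m * u s by
      rw [← h7]
      exact hVd r hr
    apply intervalIntegral.integral_congr_ae
    refine Eventually.of_forall fun x hx => ?_
    rw [uIoc_of_le hr.le] at hx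
    simp only [hu, hWV x hx.1]
  have hd1 : ∀ r, r ≠ 0 → HasDerivAt W (-(spS m u r)) r := by
    intro r hr
    rcases lt_or_gt_of_ne hr with h | h
    · have h2 := hd0 (-r) (by linarith)
      have h3 := h2.comp r (hasDerivAt_neg r)
      have h4 : W ∘ Neg.neg = W := funext hWe
      rw [spS_odd m u hue, h4] at h3
      exact h3.congr_deriv (by ring)
    · exact hd0 r h
  have hWc0 : ContinuousAt W 0 := by
    rw [continuousAt_iff_punctured_nhds, hW0]
    have habs : Tendsto (fun r : ℝ => |r|) (𝓝[≠] 0) (𝓝[>] 0) := by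
      apply tendsto_nhdsWithin_iff.mpr
      constructor
      · have : Tendsto (fun r : ℝ => |r|) (𝓝 0) (𝓝 |0|) := continuous_abs.continuousAt
        rw [abs_zero] at this
        exact this.mono_left nhdsWithin_le_nhds
      · filter_upwards [self_mem_nhdsWithin] with x hx using abs_pos.mpr hx
    refine (hlim.comp habs).congr' ?_
    filter_upwards [self_mem_nhdsWithin] with x hx
    have hx' : x ≠ 0 := hx
    simp [hW, hx']
  have hWc : Continuous W := by
    rw [continuous_iff_continuousAt]
    intro r
    rcases eq_or_ne r 0 with rfl | hr
    · exact hWc0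
    · exact (hd1 r hr).continuousAt
  have hup : ∀ k : ℕ, ContDiff ℝ k W → ContDiff ℝ k (spS m u) := fun k hk =>
    spS_contDiff m k u (hk.rpow_const_of_ne (fun x => (hWp x).ne'))
  have hSc : Continuous (spS m u) := (hup 0 (contDiff_zero.mpr hWc)).continuous
  have hd : ∀ r, HasDerivAt W (-(spS m u r)) r :=
    hasDerivAt_of_hasDerivAt_of_ne' hd1 hWc0 hSc.neg.continuousAt
  refine ⟨W, hWV, hWp, ?_, ?_⟩
  · intro k
    induction k with
    | zero => exact contDiff_zero.mpr hWc
    | succ k ih =>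
      push_cast
      rw [contDiff_succ_iff_deriv]
      refine ⟨fun r => (hd r).differentiableAt, by simp, ?_⟩
      have : deriv W = fun r => -(spS m u r) := funext fun r => (hd r).deriv
      rw [this]
      exact (hup k ih).neg
  · rw [(hd 0).deriv]
    simp [spS]


theorem sp_sq_int (m : ℕ) (hm : 1 ≤ m) (f : ℝ → ℝ) (hf : Continuous f) (C : ℝ)
    (hb : ∀ r ≥ 1, |f r| ≤ C * Real.exp (-(m : ℝ) * r)) :
    IntegrableOn (fun s => f s ^ 2 * Real.sinh s ^ m) (Ioi 0) := by
  have hm0 : (0:ℝ) < m := by exact_mod_cast hm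
  refine integrable_of_isBigO_exp_neg (b := m) hm0 ?_ ?_
  · have := Real.continuous_sinh
    exact Continuous.continuousOn (by fun_prop)
  · refine Asymptotics.IsBigO.of_bound (C ^ 2) ?_
    filter_upwards [eventually_ge_atTop 1] with x hx
    have hs : 0 < Real.sinh x := Real.sinh_pos_iff.mpr (by linarith)
    have h1 := hb x hx
    rw [Real.norm_eq_abs, Real.norm_eq_abs, abs_of_pos (Real.exp_pos _),
      abs_of_nonneg (by positivity), ← sq_abs]
    calc |f x| ^ 2 * Real.sinh x ^ m ≤ (C * Real.exp (-(m : ℝ) * x)) ^ 2 * Real.exp x ^ m := by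
          gcongr
          exact sp_sinh_le
      _ = C ^ 2 * Real.exp (-(m : ℝ) * x) := by
          rw [mul_pow, ← Real.exp_nat_mul, ← Real.exp_nat_mul, mul_assoc, ← Real.exp_add]
          congr 2
          push_cast
          ring

theorem sp_final (m : ℕ) (hm : 1 ≤ m) (p : ℝ) (hp : 1 < p) (hmp : ((m : ℝ) - 1) * (p - 1) < 4) :
    ∃ V : ℝ → ℝ, ∃ A > (0:ℝ), (∀ k : ℕ, ContDiff ℝ k V) ∧ (∀ r, 0 < V r) ∧ deriv V 0 = 0 ∧
      IntegrableOn (fun s => V s ^ 2 * Real.sinh s ^ m) (Ioi 0) ∧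
      IntegrableOn (fun s => deriv V s ^ 2 * Real.sinh s ^ m) (Ioi 0) ∧
      (∀ r > (0:ℝ), deriv (deriv V) r + (m : ℝ) * (Real.cosh r / Real.sinh r) * deriv V r
          + V r ^ p = 0) ∧
      (∀ r ∈ Ici (0:ℝ), A⁻¹ * Real.exp (-(m : ℝ) * r) ≤ V r ∧
        V r ≤ A * Real.exp (-(m : ℝ) * r)) := by
  have hm0 : (0:ℝ) < m := by exact_mod_cast hm
  obtain ⟨V, hVp, hVc, hV0, hV1, hVi, hVd⟩ := sp_base m hm p hp hmp
  obtain ⟨⟨C, hC, hVC⟩, ⟨D, hD, hgD⟩⟩ := sp_inf_bdd m hm p hp V hVp hVc hVi hVd hV1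
  have hbd := sp_zero_bdd m p hp V hVp hVi hVd hV0
  obtain ⟨W, hWV, hWp, hWs, hW0⟩ := sp_smooth m p hp V hVp hVc hVd hbd
  set g : ℝ → ℝ := fun r => ∫ s in (0:ℝ)..r, Real.sinh s ^ m * V s ^ p with hg
  have hgd := sp_g_deriv m p hp V hVc hVi
  have hWd : ∀ r > 0, HasDerivAt W (-((Real.sinh r ^ m)⁻¹ * g r)) r := by
    intro r hr
    refine (hVd r hr).congr_of_eventuallyEq ?_
    filter_upwards [lt_mem_nhds hr] with x hx using hWV x hx
  have hWc : Continuous W := (hWs 0).continuous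
  have hWc' : Continuous (deriv W) := (hWs 1).continuous_deriv le_rfl
  have hgmono : MonotoneOn g (Ioi 0) := sp_mono (convex_Ioi 0) hgd (fun x hx => by
    have := Real.sinh_pos_iff.mpr hx
    have := hVp x hx
    positivity)
  have hg1 : 0 < g 1 := by
    apply intervalIntegral.intervalIntegral_pos_of_pos_on (hVi 1 one_pos) _ one_pos
    intro x hx
    have := Real.sinh_pos_iff.mpr hx.1
    have := hVp x hx.1
    positivity
  have hup : ∀ r ≥ 1, W r ≤ C * Real.exp (-(m : ℝ) * r) := fun r hr => by
    rw [hWV r (by linarith)]; exact hVC r hr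
  have hlow : ∀ r ≥ 1, g 1 / m * Real.exp (-(m : ℝ) * r) ≤ W r := by
    intro r hr
    have hl0 : Tendsto (fun x => C * Real.exp (-(m : ℝ) * x)) atTop (𝓝 0) := by
      have := (sp_expo_tendsto (c := -(m : ℝ)) (by linarith)).const_mul C
      rwa [mul_zero] at this
    have hl1 : Tendsto (fun x => g 1 / m * Real.exp (-(m : ℝ) * x)) atTop (𝓝 0) := by
      have := (sp_expo_tendsto (c := -(m : ℝ)) (by linarith)).const_mul (g 1 / m)
      rwa [mul_zero] at this
    have hlim : Tendsto W atTop (𝓝 0) := by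
      refine squeeze_zero' ?_ ?_ hl0
      · exact Eventually.of_forall fun x => (hWp x).le
      · filter_upwards [eventually_ge_atTop 1] with x hx using hup x hx
    have := sp_le_zero (a := 1) (f := fun r => g 1 / m * Real.exp (-(m : ℝ) * r) - W r)
      (f' := fun r => g 1 / m * (-(m : ℝ) * Real.exp (-(m : ℝ) * r)) -
        -((Real.sinh r ^ m)⁻¹ * g r))
      (fun x hx => ((sp_expo_deriv _ x).const_mul _).sub (hWd x (lt_of_lt_of_le one_pos hx)))
      (fun x hx => by
        have hx1 : (1:ℝ) ≤ x := hx
        have hx0 : 0 < x := by linarith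
        have hs := Real.sinh_pos_iff.mpr hx0
        have h2 : g 1 / m * (-(m : ℝ) * Real.exp (-(m : ℝ) * x)) =
          -(Real.exp (-(m : ℝ) * x) * g 1) := by field_simp
        have h3 : Real.exp (-(m : ℝ) * x) ≤ (Real.sinh x ^ m)⁻¹ := by
          rw [neg_mul, Real.exp_neg, Real.exp_nat_mul]
          gcongr
          exact sp_sinh_le
        have h4 : g 1 ≤ g x := hgmono (mem_Ioi.mpr one_pos) (mem_Ioi.mpr hx0) hx1
        have h5 : Real.exp (-(m : ℝ) * x) * g 1 ≤ (Real.sinh x ^ m)⁻¹ * g x :=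
          mul_le_mul h3 h4 hg1.le (by positivity)
        rw [h2]
        linarith)
      (by have := hl1.sub hlim; rwa [sub_zero] at this) r hr
    linarith
  -- bounds on the compact part
  obtain ⟨M, hM⟩ := (isCompact_Icc (a := (0:ℝ)) (b := 1)).exists_bound_of_continuousOn
    hWc.continuousOn
  obtain ⟨x0, hx0, hx0m⟩ := (isCompact_Icc (a := (0:ℝ)) (b := 1)).exists_isMinOn
    (nonempty_Icc.mpr zero_le_one) hWc.continuousOn
  set c1 := min (g 1 / m) (W x0) with hc1
  have hc1p : 0 < c1 := lt_min (by positivity) (hWp x0)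
  set C1 := max C (M * Real.exp m) with hC1
  have hbnd : ∀ r ∈ Ici (0:ℝ), c1 * Real.exp (-(m : ℝ) * r) ≤ W r ∧
      W r ≤ C1 * Real.exp (-(m : ℝ) * r) := by
    intro r hr
    have hr0 : (0:ℝ) ≤ r := hr
    have he := Real.exp_pos (-(m : ℝ) * r)
    rcases le_total 1 r with h | h
    · constructor
      · exact (mul_le_mul_of_nonneg_right (min_le_left _ _) he.le).trans (hlow r h)
      · exact (hup r h).trans (mul_le_mul_of_nonneg_right (le_max_left _ _) he.le)
    · constructor
      · have h1 : Real.exp (-(m : ℝ) * r) ≤ 1 := by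
          rw [Real.exp_le_one_iff]; nlinarith
        have h2 : c1 ≤ W x0 := min_le_right _ _
        have h3 : W x0 ≤ W r := hx0m ⟨hr0, h⟩
        nlinarith
      · refine le_trans ?_ (mul_le_mul_of_nonneg_right (le_max_right _ _) he.le)
        have h1 := hM r ⟨hr0, h⟩
        rw [Real.norm_eq_abs, abs_of_pos (hWp r)] at h1
        have h2 : 1 ≤ Real.exp m * Real.exp (-(m : ℝ) * r) := by
          rw [← Real.exp_add]
          apply Real.one_le_exp
          nlinarith
        have h3 := hWp r
        rw [mul_assoc]
        nlinarith
  refine ⟨W, max C1 c1⁻¹, lt_of_lt_of_le (inv_pos.mpr hc1p) (le_max_right _ _), hWs, hWp, hW0,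
    ?_, ?_, ?_, ?_⟩
  · refine sp_sq_int m hm W hWc C fun r hr => ?_
    rw [abs_of_pos (hWp r)]
    exact hup r hr
  · refine sp_sq_int m hm _ hWc' (4 ^ m * D) fun r hr => ?_
    have hr0 : 0 < r := by linarith
    have hs := Real.sinh_pos_iff.mpr hr0
    have hg0 : 0 ≤ g r := sp_g_nonneg m p V hVp r hr0.le
    rw [(hWd r hr0).deriv, abs_neg, abs_of_nonneg (by positivity)]
    calc (Real.sinh r ^ m)⁻¹ * g r ≤ (4 ^ m * Real.exp (-(m : ℝ) * r)) * D :=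
          mul_le_mul (sp_inv_le hr) (hgD r hr) hg0 (by positivity)
      _ = _ := by ring
  · intro r hr
    have hs := Real.sinh_pos_iff.mpr hr
    have hdd : deriv W =ᶠ[𝓝 r] fun r => -((Real.sinh r ^ m)⁻¹ * g r) := by
      filter_upwards [lt_mem_nhds hr] with x hx using (hWd x hx).deriv
    have h1 : HasDerivAt (fun r => -((Real.sinh r ^ m)⁻¹ * g r))
        (-(-(m * Real.sinh r ^ (m - 1) * Real.cosh r) / (Real.sinh r ^ m) ^ 2 * g r +
          (Real.sinh r ^ m)⁻¹ * (Real.sinh r ^ m * V r ^ p))) r :=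
      ((((Real.hasDerivAt_sinh r).pow m).inv (pow_pos hs m).ne').mul (hgd r hr)).neg
    rw [hdd.deriv_eq, h1.deriv, (hWd r hr).deriv, hWV r hr]
    obtain ⟨k, rfl⟩ : ∃ k, m = k + 1 := ⟨m - 1, by omega⟩
    rw [Nat.add_sub_cancel]
    field_simp
    ring
  · intro r hr
    obtain ⟨h1, h2⟩ := hbnd r hr
    have he := Real.exp_pos (-(m : ℝ) * r)
    constructor
    · refine le_trans (mul_le_mul_of_nonneg_right ?_ he.le) h1
      rw [inv_le_comm₀ (lt_of_lt_of_le (inv_pos.mpr hc1p) (le_max_right _ _)) hc1p]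
      exact le_max_right _ _
    · exact h2.trans (mul_le_mul_of_nonneg_right (le_max_left _ _) he.le)

/-- Existence of the stationary profile with two-sided exponential bounds:
a smooth positive radial energy solution of `-ΔV = V^(1/m̃)` on `ℍ^N`. -/
theorem stationary_profile_exists
    (N : ℕ) (hN : 2 ≤ N) (mt : ℝ)
    (hm : mt ∈ Set.Ioo (((N : ℝ) - 2) / ((N : ℝ) + 2)) 1) :
    ∃ V : ℝ → ℝ, ∃ A > (0:ℝ),
      ContDiffOn ℝ (⊤ : ℕ∞) V (Set.Ici 0) ∧
      (∀ r ∈ Set.Ici (0:ℝ), 0 < V r) ∧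
      deriv V 0 = 0 ∧
      MemH1rad N V ∧
      (∀ r > (0:ℝ),
        deriv (deriv V) r + ((N : ℝ) - 1) * (Real.cosh r / Real.sinh r) * deriv V r
          + V r ^ (1 / mt) = 0) ∧
      (∀ r ∈ Set.Ici (0:ℝ),
        A⁻¹ * Real.exp (-((N : ℝ) - 1) * r) ≤ V r ∧
        V r ≤ A * Real.exp (-((N : ℝ) - 1) * r)) := by
  obtain ⟨h1, h2⟩ := hm
  have hN2 : (2:ℝ) ≤ N := by exact_mod_cast hN
  have hmt : 0 < mt := lt_of_le_of_lt (div_nonneg (by linarith) (by linarith)) h1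
  rw [div_lt_iff₀ (by linarith)] at h1
  have hcast : ((N - 1 : ℕ) : ℝ) = (N : ℝ) - 1 := by
    rw [Nat.cast_sub (by omega), Nat.cast_one]
  have hp : 1 < 1 / mt := by rw [lt_div_iff₀ hmt]; linarith
  obtain ⟨V, A, hA, hs, hpos, hd0, hi1, hi2, hode, hb⟩ := sp_final (N - 1) (by omega) (1 / mt) hp
    (by
      rw [hcast]
      have : ((N : ℝ) - 1 - 1) * (1 / mt - 1) = ((N : ℝ) - 2) * (1 - mt) / mt := by
        field_simp
        ring
      rw [this, div_lt_iff₀ hmt]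
      nlinarith)
  rw [hcast] at hode hb
  refine ⟨V, A, hA, (contDiff_infty.mpr hs).contDiffOn, fun r _ => hpos r, hd0, ⟨?_, hi1, hi2⟩,
    hode, hb⟩
  intro a b _ _
  rw [intervalIntegral.integral_deriv_eq_sub' V rfl
    (fun x _ => (hs 1).differentiable one_ne_zero x)
    ((hs 1).continuous_deriv le_rfl).continuousOn]
end

section
/- Upper spatial estimate at fixed time: let m ∈ (0,1) and let u be a radial energy solution of the fast diffusion equation with exponent m and extinction time T > 0. Then for every t* ∈ (0,T) there exists a constant Q > 0 (depending on t*, u_0, m, N) such that u(r,t*) ≤ Q e^{−(N−1)r/m} for all r ≥ 0. -/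
open MeasureTheory Set Filter Topology

/-- A radial energy solution of the fast diffusion equation `u_t = Δ(u^m)` on `ℍ^N`,
with exponent `m`, extinction time `T` (initial datum `u(·,0)`). -/
structure IsRadialEnergySolution (N : ℕ) (m T : ℝ) (u : ℝ → ℝ → ℝ) : Prop where
  continuousOn : ContinuousOn (fun p : ℝ × ℝ => u p.1 p.2) (Set.Ici 0 ×ˢ Set.Icc 0 T)
  nonneg : ∀ r ∈ Set.Ici (0:ℝ), ∀ t ∈ Set.Icc (0:ℝ) T, 0 ≤ u r t
  smooth : ContDiffOn ℝ (⊤ : ℕ∞) (fun p : ℝ × ℝ => u p.1 p.2) (Set.Ici 0 ×ˢ Set.Ioo 0 T)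
  pos : ∀ r ∈ Set.Ici (0:ℝ), ∀ t ∈ Set.Ioo (0:ℝ) T, 0 < u r t
  pde : ∀ r > (0:ℝ), ∀ t ∈ Set.Ioo (0:ℝ) T,
    deriv (fun τ => u r τ) t
      = deriv (deriv (fun ρ => u ρ t ^ m)) r
        + ((N : ℝ) - 1) * (Real.cosh r / Real.sinh r) * deriv (fun ρ => u ρ t ^ m) r
  neumann : ∀ t ∈ Set.Ioo (0:ℝ) T, deriv (fun ρ => u ρ t ^ m) 0 = 0
  extinction : ∀ r ∈ Set.Ici (0:ℝ), u r T = 0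
  energy : ∀ t ∈ Set.Ioo (0:ℝ) T, MemH1rad N (fun ρ => u ρ t ^ m)
  energy_bdd : ∀ ε ∈ Set.Ioo (0:ℝ) T, ∃ C : ℝ, ∀ t ∈ Set.Ico ε T,
    H1normSq N (fun ρ => u ρ t ^ m) ≤ C
  init_bdd : ∃ M : ℝ, ∀ r ∈ Set.Ici (0:ℝ), u r 0 ≤ M
  init_nonzero : ∃ r ∈ Set.Ici (0:ℝ), u r 0 ≠ 0
  init_energy : MemH1rad N (fun ρ => u ρ 0 ^ m)

lemma aux_second {f : ℝ → ℝ} {x : ℝ} (h : IsLocalMax f x) (hc : ContinuousAt f x) :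
    deriv (deriv f) x ≤ 0 := by
  by_contra hpos
  push Not at hpos
  have hmin := isLocalMin_of_deriv_deriv_pos hpos h.deriv_eq_zero hc
  have he : f =ᶠ[𝓝 x] fun _ => f x := by
    filter_upwards [h, hmin] with y h1 h2
    exact le_antisymm h1 h2
  have h2 : deriv (deriv f) x = 0 := by
    rw [he.deriv.deriv_eq]
    simp
  linarith

lemma aux_left {g : ℝ → ℝ} {g' a t : ℝ} (hat : a < t) (h : HasDerivAt g g' t)
    (hm : ∀ s ∈ Icc a t, g s ≤ g t) : 0 ≤ g' := by
  have h1 : Tendsto (slope g t) (𝓝[<] t) (𝓝 g') :=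
    (hasDerivAt_iff_tendsto_slope.1 h).mono_left
      (nhdsWithin_mono _ (fun y hy => ne_of_lt hy))
  refine ge_of_tendsto h1 ?_
  filter_upwards [Ioo_mem_nhdsLT hat] with s hs
  rw [slope_def_field]
  have := hm s ⟨hs.1.le, hs.2.le⟩
  exact div_nonneg_of_nonpos (by linarith) (by linarith [hs.2])

lemma aux_smooth {N : ℕ} {m T : ℝ} {u : ℝ → ℝ → ℝ} (hu : IsRadialEnergySolution N m T u)
    {r t : ℝ} (hr : 0 < r) (ht : t ∈ Ioo 0 T) :
    ContDiffAt ℝ (⊤ : ℕ∞) (fun p : ℝ × ℝ => u p.1 p.2) (r, t) := by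
  apply hu.smooth.contDiffAt
  exact prod_mem_nhds (Ici_mem_nhds hr) (Ioo_mem_nhds ht.1 ht.2)

lemma aux_smooth_r {N : ℕ} {m T : ℝ} {u : ℝ → ℝ → ℝ} (hu : IsRadialEnergySolution N m T u)
    {r t : ℝ} (hr : 0 < r) (ht : t ∈ Ioo 0 T) :
    ContDiffAt ℝ (⊤ : ℕ∞) (fun ρ => u ρ t ^ m) r := by
  have h1 : ContDiffAt ℝ (⊤ : ℕ∞) (fun ρ : ℝ => u ρ t) r :=
    ContDiffAt.comp (g := fun p : ℝ × ℝ => u p.1 p.2) (f := fun ρ : ℝ => (ρ, t)) r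
      (aux_smooth hu hr ht) (contDiffAt_id.prodMk contDiffAt_const)
  exact h1.rpow_const_of_ne (hu.pos r hr.le t ht).ne'

lemma aux_diff_t {N : ℕ} {m T : ℝ} {u : ℝ → ℝ → ℝ} (hu : IsRadialEnergySolution N m T u)
    {r t : ℝ} (hr : 0 < r) (ht : t ∈ Ioo 0 T) :
    DifferentiableAt ℝ (fun τ => u r τ) t := by
  have h1 : ContDiffAt ℝ (⊤ : ℕ∞) (fun τ : ℝ => u r τ) t :=
    ContDiffAt.comp (g := fun p : ℝ × ℝ => u p.1 p.2) (f := fun τ : ℝ => (r, τ)) t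
      (aux_smooth hu hr ht) (contDiffAt_const.prodMk contDiffAt_id)
  exact h1.differentiableAt (by simp)

lemma aux_deriv_r {N : ℕ} {m T : ℝ} {u : ℝ → ℝ → ℝ} (hu : IsRadialEnergySolution N m T u)
    {r t : ℝ} (hr : 0 < r) (ht : t ∈ Ioo 0 T) :
    DifferentiableAt ℝ (deriv (fun ρ => u ρ t ^ m)) r := by
  have h := (aux_smooth_r hu hr ht)
  have h2 : ContDiffAt ℝ 1 (fderiv ℝ (fun ρ => u ρ t ^ m)) r :=
    h.fderiv_right (WithTop.coe_le_coe.2 (le_top : (1 + 1 : ℕ∞) ≤ ⊤))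
  have h3 : deriv (fun ρ => u ρ t ^ m) = fun x => fderiv ℝ (fun ρ => u ρ t ^ m) x 1 := by
    funext x; exact (fderiv_apply_one_eq_deriv).symm
  rw [h3]
  exact (h2.clm_apply contDiffAt_const).differentiableAt (by simp)

set_option maxHeartbeats 1000000 in
lemma aux_comparison {N : ℕ} {m T : ℝ} (hN : 2 ≤ N) (hm : m ∈ Ioo (0:ℝ) 1) {u : ℝ → ℝ → ℝ}
    (hu : IsRadialEnergySolution N m T u) {b C c M t0 t1 : ℝ} (hb : 0 < b)
    (hbd : b ≤ (N:ℝ) - 1) (hC : 0 < C) (ht0 : 0 < t0) (ht01 : t0 < t1) (ht1 : t1 < T)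
    (hM : 0 ≤ M)
    (hP : ∀ r ≥ (1:ℝ), ∀ t ∈ Icc t0 t1, u r t ^ m ≤ C * Real.exp (-b * r))
    {G G1 G2 : ℝ → ℝ} (hG : ∀ r, HasDerivAt G (G1 r) r) (hG1 : ∀ r, HasDerivAt G1 (G2 r) r)
    (hGn : ∀ r ≥ (1:ℝ), 0 ≤ G r)
    (hLG : ∀ r ≥ (1:ℝ), G2 r + ((N:ℝ) - 1) * (Real.cosh r / Real.sinh r) * G1 r
      ≤ -(c * Real.exp (-(b / m) * r)))
    (hM1 : C * Real.exp (-b) ≤ M * G 1)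
    (hM2 : C ^ (1 / m) / (m * (t1 - t0)) < M * c) :
    ∀ r ≥ (1:ℝ), u r t1 ^ m ≤ M * G r := by
  intro r1 hr1
  by_contra hcon
  push Not at hcon
  obtain ⟨hm0, hm1⟩ := hm
  set d : ℝ := (N:ℝ) - 1 with hd
  set κ : ℝ := C / (t1 - t0) with hκ
  have hκ0 : 0 < κ := div_pos hC (by linarith)
  set φ : ℝ → ℝ := fun t => κ * (t1 - t) with hφ
  set Z : ℝ → ℝ → ℝ := fun r t => u r t ^ m - M * G r - φ t * Real.exp (-b * r) with hZ
  set η : ℝ := u r1 t1 ^ m - M * G r1 with hη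
  have hη0 : 0 < η := by linarith
  have hZη : Z r1 t1 = η := by simp [hZ, hφ, hη]
  -- far away
  have hlim : Tendsto (fun r : ℝ => C * Real.exp (-b * r)) atTop (𝓝 0) := by
    have h1 : Tendsto (fun r : ℝ => -b * r) atTop atBot :=
      tendsto_id.const_mul_atTop_of_neg (by linarith)
    simpa using (Real.tendsto_exp_atBot.comp h1).const_mul C
  obtain ⟨R, hRlt, hRr⟩ := ((hlim.eventually (gt_mem_nhds hη0)).and (eventually_gt_atTop r1)).exists
  have htI : ∀ t ∈ Icc t0 t1, t ∈ Ioo 0 T := fun t ht => ⟨by linarith [ht.1], by linarith [ht.2]⟩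
  have hcont : ContinuousOn (fun p : ℝ × ℝ => Z p.1 p.2) (Icc 1 R ×ˢ Icc t0 t1) := by
    have hu1 : ContinuousOn (fun p : ℝ × ℝ => u p.1 p.2 ^ m) (Icc 1 R ×ˢ Icc t0 t1) := by
      apply ContinuousOn.rpow_const
      · apply hu.continuousOn.mono
        rintro ⟨a, s⟩ ⟨ha, hs⟩
        exact ⟨le_trans zero_le_one ha.1, (htI s hs).1.le, (htI s hs).2.le⟩
      · intro x _
        exact Or.inr hm0.le
    have hGc : Continuous G := continuous_iff_continuousAt.2 fun r => (hG r).continuousAt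
    have : Continuous (fun p : ℝ × ℝ => M * G p.1 + φ p.2 * Real.exp (-b * p.1)) := by
      simp only [hφ]; fun_prop
    refine (hu1.sub this.continuousOn).congr ?_
    intro p _
    simp only [hZ, Pi.sub_apply]; ring
  obtain ⟨⟨r, t⟩, ⟨hr, ht⟩, hmax⟩ := (isCompact_Icc.prod isCompact_Icc).exists_isMaxOn
    ⟨(r1, t1), ⟨hr1, hRr.le⟩, ⟨ht01.le, le_rfl⟩⟩ hcont
  simp only at hr ht
  have hmax' : ∀ r' ∈ Icc 1 R, ∀ t' ∈ Icc t0 t1, Z r' t' ≤ Z r t := fun r' h1 t' h2 =>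
    hmax (show (r', t') ∈ Icc 1 R ×ˢ Icc t0 t1 from ⟨h1, h2⟩)
  have hge : η ≤ Z r t := hZη ▸ hmax' r1 ⟨hr1, hRr.le⟩ t1 ⟨ht01.le, le_rfl⟩
  have hφ0 : 0 ≤ φ t := mul_nonneg hκ0.le (by linarith [ht.2])
  have hφe : 0 ≤ φ t * Real.exp (-b * r) := mul_nonneg hφ0 (Real.exp_pos _).le
  have hMG : 0 ≤ M * G r := mul_nonneg hM (hGn r hr.1)
  have hvle := hP r hr.1 t ht
  have hZle : Z r t = u r t ^ m - M * G r - φ t * Real.exp (-b * r) := rfl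
  have hrne1 : 1 < r := by
    rcases hr.1.lt_or_eq with h | h
    · exact h
    · exfalso
      subst h
      simp only [mul_one] at hvle
      linarith
  have hrneR : r < R := by
    rcases hr.2.lt_or_eq with h | h
    · exact h
    · exfalso
      subst h
      linarith
  have htne : t0 < t := by
    rcases ht.1.lt_or_eq with h | h
    · exact h
    · exfalso
      have : φ t = C := by
        simp only [hφ, hκ, ← h]
        have : t1 - t0 ≠ 0 := by linarith
        field_simp
      rw [this] at hZle
      linarith
  have hr0 : 0 < r := by linarith
  have htT := htI t ht
  -- time derivative
  have hupos := hu.pos r hr0.le t htT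
  have hdt : HasDerivAt (fun τ => Z r τ)
      (deriv (fun τ => u r τ) t * m * u r t ^ (m - 1) + κ * Real.exp (-b * r)) t := by
    have h1 := (aux_diff_t hu hr0 htT).hasDerivAt.rpow_const (p := m) (Or.inl hupos.ne')
    have h2 : HasDerivAt (fun τ => φ τ * Real.exp (-b * r)) (κ * (0 - 1) * Real.exp (-b * r)) t :=
      (((hasDerivAt_const t t1).sub (hasDerivAt_id t)).const_mul κ).mul_const _
    have h3 := (h1.sub_const (M * G r)).sub h2
    refine h3.congr_deriv ?_
    ring
  have hT1 := aux_left htne hdt (fun s hs => hmax' r hr s ⟨hs.1, hs.2.trans ht.2⟩)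
  -- space derivatives
  have hloc : IsLocalMax (fun ρ => Z ρ t) r := by
    filter_upwards [Icc_mem_nhds hrne1 hrneR] with ρ hρ
    exact hmax' ρ hρ t ht
  have hexp : ∀ ρ : ℝ, HasDerivAt (fun x => Real.exp (-b * x)) (-b * Real.exp (-b * ρ)) ρ := by
    intro ρ
    have := ((hasDerivAt_id ρ).const_mul (-b)).exp
    refine this.congr_deriv ?_
    simp; ring
  have hd1 : ∀ ρ > (0:ℝ), HasDerivAt (fun ρ => Z ρ t)
      (deriv (fun ρ => u ρ t ^ m) ρ - M * G1 ρ - φ t * (-b * Real.exp (-b * ρ))) ρ := by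
    intro ρ hρ
    exact ((((aux_smooth_r hu hρ htT).differentiableAt (by simp)).hasDerivAt).sub
      ((hG ρ).const_mul M)).sub ((hexp ρ).const_mul (φ t))
  have hd2 : HasDerivAt (deriv (fun ρ => Z ρ t))
      (deriv (deriv (fun ρ => u ρ t ^ m)) r - M * G2 r
        - φ t * (-b * (-b * Real.exp (-b * r)))) r := by
    have h : HasDerivAt (fun ρ => deriv (fun ρ => u ρ t ^ m) ρ - M * G1 ρ
        - φ t * (-b * Real.exp (-b * ρ))) (deriv (deriv (fun ρ => u ρ t ^ m)) r - M * G2 r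
        - φ t * (-b * (-b * Real.exp (-b * r)))) r :=
      ((aux_deriv_r hu hr0 htT).hasDerivAt.sub ((hG1 r).const_mul M)).sub
        (((hexp r).const_mul (-b)).const_mul (φ t))
    refine h.congr_of_eventuallyEq ?_
    filter_upwards [Ioi_mem_nhds hr0] with ρ hρ
    exact (hd1 ρ hρ).deriv
  have hS1 := hloc.deriv_eq_zero
  rw [(hd1 r hr0).deriv] at hS1
  have hS2 := aux_second hloc (hd1 r hr0).continuousAt
  rw [hd2.deriv] at hS2
  have hpde := hu.pde r hr0 t htT
  rw [← hd] at hpde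
  set q := Real.cosh r / Real.sinh r with hq
  have hs0 : 0 < Real.sinh r := Real.sinh_pos_iff.2 hr0
  have hq1 : 1 ≤ q := by
    rw [hq, one_le_div hs0]
    exact (Real.sinh_lt_cosh r).le
  set E := Real.exp (-b * r) with hE
  have hE0 : 0 < E := Real.exp_pos _
  have hL := hLG r hr.1
  rw [← hq] at hL
  set ut := deriv (fun τ => u r τ) t with hut
  -- u_t ≤ M ΔG
  have hut1 : ut ≤ M * (G2 r + d * q * G1 r) := by
    have e1 : deriv (fun ρ => u ρ t ^ m) r = M * G1 r + φ t * (-b * E) := by linarith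
    rw [hpde, e1]
    have e2 : φ t * (b * E) * (b - d * q) ≤ 0 := by
      apply mul_nonpos_of_nonneg_of_nonpos
      · positivity
      · have : 0 ≤ d := by linarith
        nlinarith
    linarith
  have hut2 : ut ≤ -(M * c * Real.exp (-(b / m) * r)) := by
    have := mul_le_mul_of_nonneg_left hL hM
    linarith
  -- u_t lower bound
  have hupow : u r t ^ (1 - m) ≤ (C * E) ^ (1 / m - 1) := by
    have e1 : u r t ^ (1 - m) = (u r t ^ m) ^ (1 / m - 1) := by
      rw [← Real.rpow_mul hupos.le]
      congr 1
      field_simp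
    rw [e1]
    apply Real.rpow_le_rpow (by positivity) hvle
    rw [sub_nonneg, le_div_iff₀ hm0]; linarith
  have hone : u r t ^ (m - 1) * u r t ^ (1 - m) = 1 := by
    rw [← Real.rpow_add hupos]; simp
  have hCE : (C * E) ^ (1 / m - 1) * (C * E) = C ^ (1 / m) * Real.exp (-(b / m) * r) := by
    have hce : 0 < C * E := by positivity
    nth_rewrite 2 [← Real.rpow_one (C * E)]
    rw [← Real.rpow_add hce, sub_add_cancel, Real.mul_rpow hC.le hE0.le, hE, ← Real.exp_mul]
    congr 2
    field_simp
  have hlow : 0 ≤ ut * m + u r t ^ (1 - m) * (κ * E) := by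
    have := mul_nonneg hT1 (Real.rpow_nonneg hupos.le (1 - m))
    have e : (ut * m * u r t ^ (m - 1) + κ * E) * u r t ^ (1 - m)
      = ut * m * (u r t ^ (m - 1) * u r t ^ (1 - m)) + u r t ^ (1 - m) * (κ * E) := by ring
    rw [e, hone] at this
    linarith
  set F := Real.exp (-(b / m) * r) with hF
  have hF0 : 0 < F := Real.exp_pos _
  have hup : u r t ^ (1 - m) * (κ * E) ≤ C ^ (1 / m) * F / (t1 - t0) := by
    calc u r t ^ (1 - m) * (κ * E) ≤ (C * E) ^ (1 / m - 1) * (κ * E) :=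
          mul_le_mul_of_nonneg_right hupow (by positivity)
      _ = (C * E) ^ (1 / m - 1) * (C * E) / (t1 - t0) := by rw [hκ]; ring
      _ = _ := by rw [hCE]
  have hts : 0 < t1 - t0 := by linarith
  rw [div_lt_iff₀ (by positivity)] at hM2
  have h5 : C ^ (1 / m) * F / (t1 - t0) < m * (M * c * F) := by
    rw [div_lt_iff₀ hts]
    nlinarith
  nlinarith

lemma aux_weight (n : ℕ) {f : ℝ → ℝ} (hf : ∀ s, 0 ≤ f s)
    (hi : IntegrableOn (fun s => f s * Real.sinh s ^ n) (Ioi 0)) {r a b : ℝ} (hr : 1 ≤ r)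
    (hra : r ≤ a) (hab : a ≤ b) (hc : ContinuousOn f (Icc a b)) :
    Real.exp r ^ n / 4 ^ n * ∫ s in a..b, f s ≤ ∫ s in Ioi (0:ℝ), f s * Real.sinh s ^ n := by
  have hsh : Real.exp r / 4 ≤ Real.sinh r := by
    rw [Real.sinh_eq]
    have h1 : Real.exp (-r) * Real.exp r = 1 := by rw [← Real.exp_add]; simp
    have h2 : 2 ≤ Real.exp r := by linarith [Real.add_one_le_exp r]
    have h3 : Real.exp (-r) ≤ Real.exp r / 2 := by nlinarith [Real.exp_pos (-r)]
    linarith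
  have hsub : Ioc a b ⊆ Ioi (0:ℝ) := fun x hx => by
    simp only [mem_Ioi]; linarith [hx.1]
  have h1 : ∫ s in Ioc a b, f s * Real.sinh s ^ n ≤ ∫ s in Ioi (0:ℝ), f s * Real.sinh s ^ n := by
    apply setIntegral_mono_set hi
    · refine (ae_restrict_iff' measurableSet_Ioi).2 (Eventually.of_forall ?_)
      intro x hx
      exact mul_nonneg (hf x) (pow_nonneg (Real.sinh_nonneg_iff.2 (le_of_lt hx)) n)
    · exact hsub.eventuallyLE
  refine le_trans ?_ h1
  rw [intervalIntegral.integral_of_le hab, ← integral_const_mul]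
  apply setIntegral_mono_on
  · exact ((hc.integrableOn_compact isCompact_Icc).mono_set Ioc_subset_Icc_self).const_mul _
  · exact hi.mono_set hsub
  · exact measurableSet_Ioc
  · intro x hx
    rw [mul_comm, ← div_pow]
    apply mul_le_mul_of_nonneg_left _ (hf x)
    apply pow_le_pow_left₀ (by positivity)
    exact hsh.trans (Real.sinh_le_sinh.2 (by linarith [hx.1]))

lemma aux_init {N : ℕ} {m T : ℝ} (hN : 2 ≤ N) {u : ℝ → ℝ → ℝ}
    (hu : IsRadialEnergySolution N m T u) {t0 : ℝ} (ht0 : t0 ∈ Ioo 0 T) :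
    ∃ C > (0:ℝ), ∀ t ∈ Ico t0 T, ∀ r ≥ (1:ℝ),
      u r t ^ m ≤ C * Real.exp (-(((N:ℝ) - 1) / 2) * r) := by
  obtain ⟨A, hA⟩ := hu.energy_bdd t0 ht0
  refine ⟨1 + (|A| + 1) * 4 ^ (N - 1), by positivity, ?_⟩
  intro t ht r hr
  have htT : t ∈ Ioo 0 T := ⟨ht0.1.trans_le ht.1, ht.2⟩
  obtain ⟨hftc, hi1, hi2⟩ := hu.energy t htT
  have hAt := hA t ht
  unfold H1normSq at hAt
  set v : ℝ → ℝ := fun ρ => u ρ t ^ m with hv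
  set n := N - 1 with hn
  have hnn : ∀ f : ℝ → ℝ, (0:ℝ) ≤ ∫ s in Ioi (0:ℝ), (f s) ^ 2 * Real.sinh s ^ n := fun f => by
    apply setIntegral_nonneg measurableSet_Ioi
    intro x hx
    exact mul_nonneg (sq_nonneg _) (pow_nonneg (Real.sinh_nonneg_iff.2 (le_of_lt hx)) n)
  have hb1 : ∫ s in Ioi (0:ℝ), (v s) ^ 2 * Real.sinh s ^ n ≤ |A| := by
    linarith [hnn (deriv v), le_abs_self A]
  have hb2 : ∫ s in Ioi (0:ℝ), (deriv v s) ^ 2 * Real.sinh s ^ n ≤ |A| := by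
    linarith [hnn v, le_abs_self A]
  have hcv : ∀ a b : ℝ, r ≤ a → ContinuousOn v (Icc a b) := fun a b ha x hx =>
    (aux_smooth_r hu (by linarith [hx.1]) htT).continuousAt.continuousWithinAt
  have hcd : ∀ a b : ℝ, r ≤ a → ContinuousOn (deriv v) (Icc a b) := fun a b ha x hx =>
    (aux_deriv_r hu (by linarith [hx.1]) htT).continuousAt.continuousWithinAt
  set ε := Real.exp (-(((N:ℝ) - 1) / 2) * r) with hε
  have hε0 : 0 < ε := Real.exp_pos _
  have hS : Real.exp r ^ n * (ε * ε) = 1 := by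
    rw [hε, ← Real.exp_add, ← Real.exp_nat_mul, ← Real.exp_add, hn, Nat.cast_sub (by omega)]
    rw [Real.exp_eq_one_iff]
    push_cast; ring
  have h4 : (0:ℝ) < 4 ^ n := by positivity
  have key : ∀ X B : ℝ, Real.exp r ^ n / 4 ^ n * X ≤ B → X ≤ B * 4 ^ n * (ε * ε) := by
    intro X B h
    have h' : Real.exp r ^ n * X ≤ B * 4 ^ n := by
      rw [div_mul_eq_mul_div, div_le_iff₀ h4] at h; exact h
    calc X = (Real.exp r ^ n * X) * (ε * ε) := by linear_combination (-X) * hS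
      _ ≤ _ := mul_le_mul_of_nonneg_right h' (by positivity)
  -- a good point
  obtain ⟨s, hs, hvs⟩ : ∃ s ∈ Icc r (r + 1), (v s) ^ 2 ≤ (|A| + 1) * 4 ^ n * (ε * ε) := by
    by_contra hcon
    push Not at hcon
    have h1 := aux_weight n (fun s => sq_nonneg (v s)) hi1 hr le_rfl (by linarith : r ≤ r + 1)
      ((hcv r (r + 1) le_rfl).pow 2)
    have h2 := key _ _ (h1.trans hb1)
    have h3 : ∫ s in r..(r + 1), (|A| + 1) * 4 ^ n * (ε * ε) ≤ ∫ s in r..(r + 1), (v s) ^ 2 := by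
      apply intervalIntegral.integral_mono_on (by linarith) (by simp)
      · apply ContinuousOn.intervalIntegrable
        rw [uIcc_of_le (by linarith)]
        exact (hcv r (r + 1) le_rfl).pow 2
      · intro x hx; exact (hcon x hx).le
    simp at h3
    have : 0 < 4 ^ n * (ε * ε) := by positivity
    nlinarith
  have hint : ContinuousOn (fun x => (deriv v x) ^ 2) (Icc r s) := (hcd r s le_rfl).pow 2
  have h1 := aux_weight n (fun s => sq_nonneg (deriv v s)) hi2 hr le_rfl hs.1 hint
  have h2 := key _ _ (h1.trans hb2)
  have hf := hftc r s (by linarith) hs.1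
  have h3 : ∫ x in r..s, (-ε / 2 - (deriv v x) ^ 2 / (2 * ε)) ≤ ∫ x in r..s, deriv v x := by
    apply intervalIntegral.integral_mono_on hs.1
    · apply ContinuousOn.intervalIntegrable
      rw [uIcc_of_le hs.1]
      exact continuousOn_const.sub (hint.div_const _)
    · apply ContinuousOn.intervalIntegrable
      rw [uIcc_of_le hs.1]
      exact hcd r s le_rfl
    · intro x _
      have e : deriv v x - (-ε / 2 - (deriv v x) ^ 2 / (2 * ε)) = (deriv v x + ε) ^ 2 / (2 * ε) := by
        field_simp; ring
      have : 0 ≤ (deriv v x + ε) ^ 2 / (2 * ε) := by positivity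
      linarith
  have hii : IntervalIntegrable (fun x => (deriv v x) ^ 2 / (2 * ε)) volume r s := by
    apply ContinuousOn.intervalIntegrable
    rw [uIcc_of_le hs.1]
    exact hint.div_const _
  rw [intervalIntegral.integral_sub (by simp) hii,
    intervalIntegral.integral_const, smul_eq_mul, intervalIntegral.integral_div] at h3
  have h5 : (∫ x in r..s, (deriv v x) ^ 2) / (2 * ε) ≤ |A| * 4 ^ n * ε / 2 := by
    rw [div_le_iff₀ (by positivity)]
    linarith
  have h6 : v s ≤ ε / 2 + (v s) ^ 2 / (2 * ε) := by
    have e : ε / 2 + (v s) ^ 2 / (2 * ε) - v s = (v s - ε) ^ 2 / (2 * ε) := by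
      field_simp; ring
    have : 0 ≤ (v s - ε) ^ 2 / (2 * ε) := by positivity
    linarith
  have h7 : (v s) ^ 2 / (2 * ε) ≤ (|A| + 1) * 4 ^ n * ε / 2 := by
    rw [div_le_iff₀ (by positivity)]
    linarith
  have h8 : (s - r) * (-ε / 2) ≥ -ε / 2 := by nlinarith [hs.2]
  have h9 : 0 < 4 ^ n * ε := by positivity
  change v r ≤ _
  linarith

lemma aux_step {N : ℕ} {m T : ℝ} (hN : 2 ≤ N) (hm : m ∈ Ioo (0:ℝ) 1) {u : ℝ → ℝ → ℝ}
    (hu : IsRadialEnergySolution N m T u) {b b' c ts : ℝ} (hts : ts < T) (hb : 0 < b)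
    (hbd : b ≤ (N:ℝ) - 1) (hc : 0 < c)
    (hP : ∀ t0 ∈ Ioc 0 ts, ∃ C > (0:ℝ), ∀ t ∈ Icc t0 ts, ∀ r ≥ (1:ℝ),
      u r t ^ m ≤ C * Real.exp (-b * r))
    {G G1 G2 : ℝ → ℝ} (hG : ∀ r, HasDerivAt G (G1 r) r) (hG1 : ∀ r, HasDerivAt G1 (G2 r) r)
    (hGn : ∀ r ≥ (1:ℝ), 0 < G r) (hGb : ∀ r ≥ (1:ℝ), G r ≤ Real.exp (-b' * r))
    (hLG : ∀ r ≥ (1:ℝ), G2 r + ((N:ℝ) - 1) * (Real.cosh r / Real.sinh r) * G1 r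
      ≤ -(c * Real.exp (-(b / m) * r))) :
    ∀ t0 ∈ Ioc 0 ts, ∃ C > (0:ℝ), ∀ t ∈ Icc t0 ts, ∀ r ≥ (1:ℝ),
      u r t ^ m ≤ C * Real.exp (-b' * r) := by
  rintro t0 ⟨h0, h0s⟩
  obtain ⟨C, hC, hCb⟩ := hP (t0 / 2) ⟨by linarith, by linarith⟩
  have hm0 := hm.1
  have hg1 := hGn 1 le_rfl
  have hCm : 0 < C ^ (1 / m) := Real.rpow_pos_of_pos hC _
  set X := C ^ (1 / m) / (m * (t0 / 2)) with hX
  have hX0 : 0 < X := by positivity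
  set M := C * Real.exp (-b) / G 1 + (X + 1) / c with hM
  have hM0 : 0 < M := by positivity
  refine ⟨M, hM0, ?_⟩
  intro t1 ht1 r hr
  have h := aux_comparison hN hm hu (M := M) (t0 := t0 / 2) (t1 := t1) hb hbd hC (by linarith)
    (by linarith [ht1.1]) (by linarith [ht1.2]) hM0.le
    (fun r hr t ht => hCb t ⟨ht.1, ht.2.trans ht1.2⟩ r hr) hG hG1 (fun r hr => (hGn r hr).le)
    hLG ?_ ?_ r hr
  · exact h.trans (mul_le_mul_of_nonneg_left (hGb r hr) hM0.le)
  · have : M * G 1 = C * Real.exp (-b) + (X + 1) / c * G 1 := by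
      rw [hM]; field_simp
    rw [this]
    have : 0 < (X + 1) / c * G 1 := by positivity
    linarith
  · have e : M * c = C * Real.exp (-b) / G 1 * c + (X + 1) := by
      rw [hM]; field_simp
    have : 0 < C * Real.exp (-b) / G 1 * c := by positivity
    have h2 : C ^ (1 / m) / (m * (t1 - t0 / 2)) ≤ X := by
      rw [hX]
      apply div_le_div_of_nonneg_left hCm.le (by positivity)
      apply mul_le_mul_of_nonneg_left _ hm0.le
      linarith [ht1.1]
    linarith

lemma aux_exp (b ρ : ℝ) : HasDerivAt (fun x => Real.exp (-b * x)) (-b * Real.exp (-b * ρ)) ρ := by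
  have := ((hasDerivAt_id ρ).const_mul (-b)).exp
  refine this.congr_deriv ?_
  simp; ring

lemma aux_coth {r : ℝ} (hr : 1 ≤ r) : 1 ≤ Real.cosh r / Real.sinh r := by
  rw [one_le_div (Real.sinh_pos_iff.2 (by linarith))]
  exact (Real.sinh_lt_cosh r).le

lemma aux_step1 {N : ℕ} {m T : ℝ} (hN : 2 ≤ N) (hm : m ∈ Ioo (0:ℝ) 1) {u : ℝ → ℝ → ℝ}
    (hu : IsRadialEnergySolution N m T u) {b b' ts : ℝ} (hts : ts < T) (hb : 0 < b)
    (hbd : b ≤ (N:ℝ) - 1) (hb' : 0 < b') (hbd' : b' < (N:ℝ) - 1) (hbb : b' ≤ b / m)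
    (hP : ∀ t0 ∈ Ioc 0 ts, ∃ C > (0:ℝ), ∀ t ∈ Icc t0 ts, ∀ r ≥ (1:ℝ),
      u r t ^ m ≤ C * Real.exp (-b * r)) :
    ∀ t0 ∈ Ioc 0 ts, ∃ C > (0:ℝ), ∀ t ∈ Icc t0 ts, ∀ r ≥ (1:ℝ),
      u r t ^ m ≤ C * Real.exp (-b' * r) := by
  have hc : 0 < b' * ((N:ℝ) - 1 - b') := mul_pos hb' (by linarith)
  refine aux_step (c := b' * ((N:ℝ) - 1 - b')) hN hm hu hts hb hbd hc hP
    (G := fun x => Real.exp (-b' * x))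
    (G1 := fun x => -b' * Real.exp (-b' * x)) (G2 := fun x => -b' * (-b' * Real.exp (-b' * x)))
    (aux_exp b') (fun r => (aux_exp b' r).const_mul _) (fun r _ => Real.exp_pos _)
    (fun r _ => le_rfl) ?_
  intro r hr
  have hq := aux_coth hr
  set q := Real.cosh r / Real.sinh r
  have h1 : Real.exp (-(b / m) * r) ≤ Real.exp (-b' * r) := by
    apply Real.exp_le_exp.2; nlinarith
  have h2 := mul_le_mul_of_nonneg_left h1 hc.le
  have h3 : 0 ≤ ((N:ℝ) - 1) * (q - 1) * (b' * Real.exp (-b' * r)) := by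
    have : 0 ≤ (N:ℝ) - 1 := by linarith
    have : 0 ≤ q - 1 := by linarith
    positivity
  nlinarith

lemma aux_step2 {N : ℕ} {m T : ℝ} (hN : 2 ≤ N) (hm : m ∈ Ioo (0:ℝ) 1) {u : ℝ → ℝ → ℝ}
    (hu : IsRadialEnergySolution N m T u) {b ts : ℝ} (hts : ts < T) (hb : 0 < b)
    (hbd : b ≤ (N:ℝ) - 1) (hbb : (N:ℝ) - 1 < b / m)
    (hP : ∀ t0 ∈ Ioc 0 ts, ∃ C > (0:ℝ), ∀ t ∈ Icc t0 ts, ∀ r ≥ (1:ℝ),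
      u r t ^ m ≤ C * Real.exp (-b * r)) :
    ∀ t0 ∈ Ioc 0 ts, ∃ C > (0:ℝ), ∀ t ∈ Icc t0 ts, ∀ r ≥ (1:ℝ),
      u r t ^ m ≤ C * Real.exp (-((N:ℝ) - 1) * r) := by
  set d := (N:ℝ) - 1 with hd
  have hd0 : 0 < d := by linarith
  obtain ⟨γ, hγ0, hγd, hγb⟩ : ∃ γ : ℝ, 0 < γ ∧ γ ≤ d ∧ d + γ ≤ b / m :=
    ⟨min d (b / m - d), lt_min hd0 (by linarith), min_le_left _ _,
      by linarith [min_le_right d (b / m - d)]⟩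
  have hc : 0 < (d + γ) * γ / 2 := by positivity
  refine aux_step (c := (d + γ) * γ / 2) hN hm hu hts hb hbd hc hP
    (G := fun x => Real.exp (-d * x) - 1 / 2 * Real.exp (-(d + γ) * x))
    (G1 := fun x => -d * Real.exp (-d * x) - 1 / 2 * (-(d + γ) * Real.exp (-(d + γ) * x)))
    (G2 := fun x => -d * (-d * Real.exp (-d * x))
      - 1 / 2 * (-(d + γ) * (-(d + γ) * Real.exp (-(d + γ) * x))))
    (fun r => (aux_exp d r).sub ((aux_exp (d + γ) r).const_mul _))
    (fun r => ((aux_exp d r).const_mul _).sub (((aux_exp (d + γ) r).const_mul _).const_mul _))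
    ?_ ?_ ?_
  · intro r hr
    have h1 : Real.exp (-(d + γ) * r) ≤ Real.exp (-d * r) := by
      apply Real.exp_le_exp.2; nlinarith
    linarith [Real.exp_pos (-d * r)]
  · intro r hr
    linarith [Real.exp_pos (-(d + γ) * r)]
  intro r hr
  have hq := aux_coth hr
  rw [← hd]
  set q := Real.cosh r / Real.sinh r
  have h0 : Real.exp (-(d + γ) * r) ≤ Real.exp (-d * r) := by
    apply Real.exp_le_exp.2; nlinarith
  have h1 : Real.exp (-(b / m) * r) ≤ Real.exp (-(d + γ) * r) := by
    apply Real.exp_le_exp.2; nlinarith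
  have h2 := mul_le_mul_of_nonneg_left h1 hc.le
  have hF := Real.exp_pos (-(d + γ) * r)
  set E := Real.exp (-d * r)
  set F := Real.exp (-(d + γ) * r)
  have h3 : (d + γ) / 2 * F ≤ d * E := by
    apply mul_le_mul (by linarith) h0 hF.le hd0.le
  have h4 : 0 ≤ d * (q - 1) * (d * E - (d + γ) / 2 * F) :=
    mul_nonneg (mul_nonneg hd0.le (by linarith)) (by linarith)
  refine le_trans (le_of_eq_of_le (b := -((d + γ) * γ / 2 * F)
    - d * (q - 1) * (d * E - (d + γ) / 2 * F)) (by ring) (by linarith)) (neg_le_neg h2)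

/-- Upper spatial estimate at any fixed time, for all `m ∈ (0,1)`. -/
theorem upper_estimate_fixed_time
    (N : ℕ) (hN : 2 ≤ N) (m T : ℝ)
    (hm : m ∈ Set.Ioo (0:ℝ) 1) (hT : 0 < T)
    (u : ℝ → ℝ → ℝ) (hu : IsRadialEnergySolution N m T u) :
    ∀ ts ∈ Set.Ioo (0:ℝ) T, ∃ Q > (0:ℝ), ∀ r ∈ Set.Ici (0:ℝ),
      u r ts ≤ Q * Real.exp (-((N : ℝ) - 1) * r / m) := by

  rintro ts ⟨hts0, htsT⟩
  obtain ⟨hm0, hm1⟩ := hm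
  have hN2 : (2:ℝ) ≤ N := by exact_mod_cast hN
  set d := (N:ℝ) - 1 with hd
  have hd0 : 0 < d := by linarith
  -- exponents
  set β := (1 + m) / 2 * d with hβ
  have hβ0 : 0 < β := by positivity
  have hβd : β < d := by nlinarith
  have hβm : m * d < β := by nlinarith
  have hdm : ∀ k : ℕ, 0 < min (d / 2 * (1 / m) ^ k) β := fun k => lt_min (by positivity) hβ0
  have hind : ∀ k : ℕ, ∀ t0 ∈ Ioc 0 ts, ∃ C > (0:ℝ), ∀ t ∈ Icc t0 ts, ∀ r ≥ (1:ℝ),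
      u r t ^ m ≤ C * Real.exp (-(min (d / 2 * (1 / m) ^ k) β) * r) := by
    intro k
    induction k with
    | zero =>
      rintro t0 ⟨h0, h0s⟩
      obtain ⟨C, hC, h⟩ := aux_init hN hu (t0 := t0) ⟨h0, by linarith⟩
      refine ⟨C, hC, fun t ht r hr => (h t ⟨ht.1, by linarith [ht.2]⟩ r hr).trans ?_⟩
      apply mul_le_mul_of_nonneg_left _ hC.le
      apply Real.exp_le_exp.2
      have : min (d / 2 * (1 / m) ^ 0) β ≤ d / 2 := (min_le_left _ _).trans (by simp)
      nlinarith
    | succ k ih =>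
      refine aux_step1 hN ⟨hm0, hm1⟩ hu htsT (hdm k) ((min_le_right _ _).trans hβd.le) (hdm _)
        ((min_le_right _ _).trans_lt hβd) ?_ ih
      rw [le_div_iff₀ hm0]
      apply le_min
      · calc min (d / 2 * (1 / m) ^ (k + 1)) β * m ≤ d / 2 * (1 / m) ^ (k + 1) * m :=
              mul_le_mul_of_nonneg_right (min_le_left _ _) hm0.le
          _ = d / 2 * (1 / m) ^ k := by rw [pow_succ]; field_simp
      · calc min (d / 2 * (1 / m) ^ (k + 1)) β * m ≤ β * m :=
              mul_le_mul_of_nonneg_right (min_le_right _ _) hm0.le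
          _ ≤ β := by nlinarith
  obtain ⟨k, hk⟩ := pow_unbounded_of_one_lt 2 (show 1 < 1 / m by rw [lt_div_iff₀ hm0]; linarith)
  have hmin : min (d / 2 * (1 / m) ^ k) β = β := by
    apply min_eq_right
    nlinarith
  have hβP := hind k
  rw [hmin] at hβP
  have hfin := aux_step2 hN ⟨hm0, hm1⟩ hu htsT hβ0 hβd.le
    (by rw [lt_div_iff₀ hm0]; linarith) hβP
  obtain ⟨C, hC, hCb⟩ := hfin ts ⟨hts0, le_rfl⟩
  -- near the origin
  have hcont : ContinuousOn (fun r => u r ts) (Icc 0 1) := by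
    apply hu.continuousOn.comp (f := fun r : ℝ => (r, ts)) (by fun_prop)
    intro r hr
    exact ⟨hr.1, hts0.le, htsT.le⟩
  obtain ⟨B, hB⟩ := isCompact_Icc.bddAbove_image hcont
  have hCm : 0 < C ^ (1 / m) := Real.rpow_pos_of_pos hC _
  refine ⟨C ^ (1 / m) + |B| * Real.exp (d / m), by positivity, ?_⟩
  intro r hr
  have hr0 : 0 ≤ r := hr
  have hexp := Real.exp_pos (-d * r / m)
  rcases le_total 1 r with h1 | h1
  · have h := hCb ts ⟨le_rfl, le_rfl⟩ r h1
    have hp := hu.pos r hr ts ⟨hts0, htsT⟩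
    have h2 : u r ts = (u r ts ^ m) ^ (1 / m) := by
      rw [← Real.rpow_mul hp.le, mul_one_div_cancel hm0.ne', Real.rpow_one]
    have h3 : u r ts ≤ C ^ (1 / m) * Real.exp (-d * r / m) := by
      rw [h2]
      calc _ ≤ (C * Real.exp (-d * r)) ^ (1 / m) :=
            Real.rpow_le_rpow (by positivity) h (by positivity)
        _ = _ := by
            rw [Real.mul_rpow hC.le (Real.exp_pos _).le, ← Real.exp_mul]
            congr 2; ring
    have : 0 ≤ |B| * Real.exp (d / m) * Real.exp (-d * r / m) := by positivity
    linarith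
  · have h2 : u r ts ≤ B := hB ⟨r, ⟨hr0, h1⟩, rfl⟩
    have h3 : 1 ≤ Real.exp (d / m) * Real.exp (-d * r / m) := by
      rw [← Real.exp_add]
      apply Real.one_le_exp
      have : d / m + -d * r / m = d * (1 - r) / m := by ring
      rw [this]
      exact div_nonneg (mul_nonneg hd0.le (by linarith)) hm0.le
    have h4 : 0 ≤ C ^ (1 / m) * Real.exp (-d * r / m) := by positivity
    nlinarith [le_abs_self B, abs_nonneg B]
end
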